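/- arXiv:1708.03609 — 5 statements merged into one kernel-verified Lean document; each statement's English description precedes it below -/
import Mathlib

section
/- Let G be a 3-connected planar graph and let X = {a,b,c,d} be a set of four distinct vertices of G. Then G has a K4(X)-minor or a W4(X)-minor. -/
namespace Paper

open SimpleGraph

variable {V : Type*} {U : Type*}

/-- An `H`-model in `G`: pairwise vertex-disjoint connected branch sets indexed by the
vertices of `H`, with an edge of `G` between the branch sets of any two vertices
adjacent in `H`. -/
structure IsModel (G : SimpleGraph V) {W : Type*} (H : SimpleGraph W) (B : W → Set V) :
    Prop where
  connected : ∀ x : W, (G.induce (B x)).Connected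
  disjoint : ∀ x y : W, x ≠ y → Disjoint (B x) (B y)
  adj_of_adj : ∀ ⦃x y : W⦄, H.Adj x y → ∃ u ∈ B x, ∃ v ∈ B y, G.Adj u v

/-- `G` is `k`-connected: it has more than `k` vertices, and deleting any set of fewer
than `k` vertices leaves a connected graph. -/
def KConnected (G : SimpleGraph V) [Fintype V] (k : ℕ) : Prop :=
  k < Fintype.card V ∧ ∀ S : Set V, S.ncard < k → (G.induce Sᶜ).Connected

/-- A separation of `G`: a pair of vertex sets covering `V(G)` with no edge of `G`
between `A \ B` and `B \ A`. -/
def IsSeparation (G : SimpleGraph V) (A B : Set V) : Prop :=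
  A ∪ B = Set.univ ∧ ∀ u v : V, u ∈ A \ B → v ∈ B \ A → ¬ G.Adj u v

/-- The reversal of darts, as a permutation. -/
def dartSymmPerm (G : SimpleGraph V) : Equiv.Perm G.Dart :=
  Function.Involutive.toPerm _ SimpleGraph.Dart.symm_involutive

/-- A combinatorial embedding (rotation system) of a graph: a permutation of the darts
preserving initial vertices, giving for each vertex the cyclic order of the darts
leaving it. -/
structure RotationSystem (G : SimpleGraph V) where
  rot : Equiv.Perm G.Dart
  fst_rot : ∀ d : G.Dart, (rot d).toProd.1 = d.toProd.1

namespace RotationSystem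

variable {G : SimpleGraph V} (R : RotationSystem G)

/-- The face-tracing permutation of a rotation system. -/
def facePerm : Equiv.Perm G.Dart := (dartSymmPerm G).trans R.rot

/-- Two darts lie on a common face of the embedding. -/
def sameFace (d d' : G.Dart) : Prop := ∃ n : ℤ, (R.facePerm ^ n) d = d'

/-- Darts up to lying on a common face; the classes are the faces of the embedding. -/
def faceSetoid : Setoid G.Dart where
  r := R.sameFace
  iseqv := by
    constructor
    · intro d; exact ⟨0, by simp⟩
    · rintro d d' ⟨n, rfl⟩
      refine ⟨-n, ?_⟩
      rw [← Equiv.Perm.mul_apply, ← zpow_add, neg_add_cancel, zpow_zero, Equiv.Perm.one_apply]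
    · rintro d d' d'' ⟨n, rfl⟩ ⟨m, rfl⟩
      refine ⟨n + m, ?_⟩
      rw [add_comm, zpow_add, Equiv.Perm.mul_apply]

/-- The number of faces of the embedding. -/
noncomputable def numFaces : ℕ := Nat.card (Quotient R.faceSetoid)

/-- The rotation system is a planar embedding: it satisfies Euler's formula
`|V| - |E| + |F| = 2`. -/
def IsPlanarEmbedding : Prop :=
  (Nat.card V : ℤ) - (Nat.card G.edgeSet : ℤ) + (R.numFaces : ℤ) = 2

/-- The set of edges appearing on the face of the dart `d₀`. -/
def faceEdges (d₀ : G.Dart) : Set (Sym2 V) := {e | ∃ d : G.Dart, R.sameFace d₀ d ∧ d.edge = e}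

/-- The face of `d₀` traverses each of its edges exactly once. -/
def FaceEdgeInj (d₀ : G.Dart) : Prop :=
  ∀ d d' : G.Dart, R.sameFace d₀ d → R.sameFace d₀ d' → d.edge = d'.edge → d = d'

/-- The face of `d₀` is bounded by the closed curve with edge set `E`, traversing each
of its edges exactly once. -/
def IsFaceBoundary (d₀ : G.Dart) (E : Set (Sym2 V)) : Prop :=
  R.FaceEdgeInj d₀ ∧ R.faceEdges d₀ = E

end RotationSystem

/-- A (finite, connected) graph is planar if it admits a rotation system satisfying
Euler's formula. -/
def IsPlanar (G : SimpleGraph V) : Prop := ∃ R : RotationSystem G, R.IsPlanarEmbedding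

/-- The wheel `W₄`: the 4-cycle `0-1-2-3-0` together with the hub `4`. -/
def W4 : SimpleGraph (Fin 5) := SimpleGraph.fromRel (fun i j =>
  (i, j) ∈ ([(0, 1), (1, 2), (2, 3), (3, 0), (4, 0), (4, 1), (4, 2), (4, 3)] :
    List (Fin 5 × Fin 5)))

/-- `G` has a `K₄(X)`-minor for `X = {a,b,c,d}`: a `K₄`-model of `G` in which the four
roots lie in four distinct branch sets. -/
def HasK4XMinor (G : SimpleGraph V) (a b c d : V) : Prop :=
  ∃ (B : Fin 4 → Set V) (f : Fin 4 → Fin 4), Function.Injective f ∧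
    IsModel G (⊤ : SimpleGraph (Fin 4)) B ∧
    a ∈ B (f 0) ∧ b ∈ B (f 1) ∧ c ∈ B (f 2) ∧ d ∈ B (f 3)

/-- `G` has a `W₄(X)`-minor for `X = {a,b,c,d}`: a `W₄`-model of `G` in which the four
roots lie in four distinct branch sets of rim (4-cycle) vertices. -/
def HasW4XMinor (G : SimpleGraph V) (a b c d : V) : Prop :=
  ∃ (B : Fin 5 → Set V) (f : Fin 4 → Fin 5), Function.Injective f ∧ (∀ i, f i ≠ 4) ∧
    IsModel G W4 B ∧
    a ∈ B (f 0) ∧ b ∈ B (f 1) ∧ c ∈ B (f 2) ∧ d ∈ B (f 3)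

/-! ### Connectivity of induced subgraphs -/

/-- An induced subgraph is connected iff it is nonempty and every nonempty subset closed
under adjacency is everything. -/
theorem induce_connected_iff (G : SimpleGraph V) (A : Set V) :
    (G.induce A).Connected ↔ A.Nonempty ∧ ∀ P : Set V, (∃ s ∈ A, s ∈ P) →
      (∀ s ∈ A, s ∈ P → ∀ t ∈ A, G.Adj s t → t ∈ P) → ∀ t ∈ A, t ∈ P := by
  constructor
  · intro h
    refine ⟨Set.nonempty_coe_sort.mp h.nonempty, ?_⟩
    rintro P ⟨s, hsA, hsP⟩ hP t htA
    obtain ⟨p⟩ := h.preconnected ⟨s, hsA⟩ ⟨t, htA⟩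
    by_contra htP
    obtain ⟨e, -, h₁, h₂⟩ :=
      p.exists_boundary_dart {v | (v : V) ∈ P} hsP htP
    exact h₂ (hP _ e.fst.2 h₁ _ e.snd.2 e.adj)
  · rintro ⟨⟨s, hs⟩, h⟩
    refine (SimpleGraph.connected_iff_exists_forall_reachable _).2 ⟨⟨s, hs⟩, ?_⟩
    rintro ⟨t, ht⟩
    obtain ⟨_, hr⟩ := h {v | ∃ hv : v ∈ A, (G.induce A).Reachable ⟨s, hs⟩ ⟨v, hv⟩}
      ⟨s, hs, hs, .refl _⟩
      (fun p hp hpr q hq hpq => ⟨hq, hpr.2.trans (SimpleGraph.Adj.reachable hpq)⟩) t ht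
    exact hr

theorem induce_singleton_connected (G : SimpleGraph V) (v : V) :
    (G.induce {v}).Connected := by
  rw [induce_connected_iff]
  exact ⟨⟨v, rfl⟩, by rintro P ⟨s, rfl, hs⟩ - t rfl; exact hs⟩

theorem induce_pair_connected_of_adj {G : SimpleGraph V} {u v : V} (h : G.Adj u v) :
    (G.induce {u, v}).Connected := by
  rw [induce_connected_iff]
  refine ⟨⟨u, by simp⟩, fun P hs hP t ht => ?_⟩
  have := h.symm
  grind

/-! ### Separators of order at most three -/

/-- `F` is a nonempty set, disjoint from `{p, q, r}`, all of whose outside neighbours lie in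
`{p, q, r}`, and some vertex lies outside `F ∪ {p, q, r}`. -/
def IsFragment (G : SimpleGraph V) (F : Set V) (p q r : V) : Prop :=
  (∃ t, t ∈ F) ∧ (∃ t, t ∉ F ∧ t ≠ p ∧ t ≠ q ∧ t ≠ r) ∧ p ∉ F ∧ q ∉ F ∧ r ∉ F ∧
    ∀ s ∈ F, ∀ t, G.Adj s t → t ∈ F ∨ t = p ∨ t = q ∨ t = r

theorem IsFragment.compl {G : SimpleGraph V} {F : Set V} {p q r : V}
    (h : IsFragment G F p q r) :
    IsFragment G {t | t ∉ F ∧ t ≠ p ∧ t ≠ q ∧ t ≠ r} p q r := by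
  obtain ⟨⟨s, hs⟩, ⟨t, ht⟩, hp, hq, hr, hN⟩ := h
  refine ⟨⟨t, ht⟩, ⟨s, ?_, ?_⟩, ?_, ?_, ?_, ?_⟩
  · grind
  · grind
  · simp
  · simp
  · simp
  · intro x hx y hxy
    have := hxy.symm
    have := hN y
    grind

theorem IsFragment.rotate {G : SimpleGraph V} {F : Set V} {p q r : V}
    (h : IsFragment G F p q r) : IsFragment G F q r p := by
  obtain ⟨h₁, ⟨t, ht⟩, hp, hq, hr, hN⟩ := h
  refine ⟨h₁, ⟨t, by grind⟩, hq, hr, hp, by grind⟩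

theorem KConnected.not_isFragment [Fintype V] {G : SimpleGraph V} (hG : KConnected G 3)
    (F : Set V) (p q : V) : ¬ IsFragment G F p q q := by
  rintro ⟨⟨s, hs⟩, ⟨t, ht, htp, htq, -⟩, hp, hq, -, hN⟩
  have hc : ({p, q} : Set V).ncard < 3 := by
    have := Set.ncard_insert_le p {q}
    rw [Set.ncard_singleton] at this
    omega
  have h := ((induce_connected_iff G _).1 (hG.2 {p, q} hc)).2 F
    ⟨s, by simp only [Set.mem_compl_iff, Set.mem_insert_iff, Set.mem_singleton_iff]; grind, hs⟩
    (fun x _ hx y hy hxy => by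
      simp only [Set.mem_compl_iff, Set.mem_insert_iff, Set.mem_singleton_iff] at hy
      have := hN x hx y hxy
      tauto) t
    (by simp [htp, htq])
  exact ht h

theorem IsFragment.exists_adj_mem {G : SimpleGraph V}
    (h₂ : ∀ (F : Set V) (p q : V), ¬ IsFragment G F p q q)
    {F : Set V} {p q r : V} (h : IsFragment G F p q r) : ∃ t ∈ F, G.Adj p t := by
  by_contra! hno
  obtain ⟨h₁, ⟨t, ht⟩, hp, hq, hr, hN⟩ := h
  refine h₂ F q r ⟨h₁, ⟨t, by grind⟩, hq, hr, hr, fun s hs t hst => ?_⟩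
  have := hno s hs
  have := hN s hs t hst
  have := hst.symm
  grind

theorem IsFragment.inter_of_notMem {G : SimpleGraph V}
    (h₂ : ∀ (F : Set V) (p q : V), ¬ IsFragment G F p q q)
    {F E : Set V} {u v w y z : V} (hF : IsFragment G F u y z) (hE : IsFragment G E u v w)
    (hv : v ∈ F) (hy : y ∉ E) (hz : z ∉ E) : IsFragment G (E ∩ F) u v w := by
  obtain ⟨t, htE, hvt⟩ := hE.rotate.exists_adj_mem h₂
  obtain ⟨-, -, -, -, -, hNF⟩ := hF
  obtain ⟨-, ⟨s, hs⟩, hu, hvE, hw, hNE⟩ := hE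
  have := hNF v hv t hvt
  refine ⟨⟨t, by grind⟩, ⟨s, by grind⟩, by grind, by grind, by grind, fun p hp q hpq => ?_⟩
  have := hNF p hp.2 q hpq
  have := hNE p hp.1 q hpq
  grind

/-- If `{u, y, z}` and `{u, v, w}` are crossing separators with `v ∈ F`, then either `w ∉ F` and
the corner `E ∩ F` is empty or a fragment with boundary in `{u, v, y}`, or `w ∈ F` and the
opposite corner is empty. -/
theorem IsFragment.crossing {G : SimpleGraph V}
    (h₂ : ∀ (F : Set V) (p q : V), ¬ IsFragment G F p q q)
    {F E : Set V} {u v w y z : V} (hF : IsFragment G F u y z) (hE : IsFragment G E u v w)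
    (hv : v ∈ F) (hy : y ∈ E) (hz : z ∉ E) (hzw : z ≠ w) :
    (w ∉ F ∧ ∀ t ∈ E, t ∈ F → IsFragment G (E ∩ F) u v y) ∨
      (w ∈ F ∧ ∀ t ∈ E, t ∈ F ∨ t = y) := by
  have huz : u ≠ z := by
    rintro rfl
    exact h₂ F y u hF.rotate
  obtain ⟨-, -, hu, hyF, hzF, hNF⟩ := id hF
  obtain ⟨-, ⟨s, hs⟩, huE, hvE, hwE, hNE⟩ := hE
  by_cases hw : w ∈ F
  · refine .inr ⟨hw, fun t htE => ?_⟩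
    by_contra! hno
    obtain ⟨-, -, -, -, -, hNF'⟩ := hF.compl
    refine h₂ (E ∩ {t | t ∉ F ∧ t ≠ u ∧ t ≠ y ∧ t ≠ z}) u y
      ⟨⟨t, htE, by grind⟩, ⟨z, by grind⟩, by grind, by grind, by grind, fun p hp q hpq => ?_⟩
    have := hNF' p hp.2 q hpq
    have := hNE p hp.1 q hpq
    grind
  · refine .inl ⟨hw, fun t htE htF => ?_⟩
    refine ⟨⟨t, htE, htF⟩, ⟨z, by grind⟩, by grind, by grind, by grind, fun p hp q hpq => ?_⟩
    have := hNF p hp.2 q hpq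
    have := hNE p hp.1 q hpq
    grind

theorem IsFragment.eq_singleton_or_exists_subset {G : SimpleGraph V}
    (h₂ : ∀ (F : Set V) (p q : V), ¬ IsFragment G F p q q)
    {F E : Set V} {u v w y z : V} (hF : IsFragment G F u y z) (hE : IsFragment G E u v w)
    (hv : v ∈ F) : F = {v} ∨ ∃ F' ⊆ F, v ∉ F' ∧ ∃ q r, IsFragment G F' u q r := by
  have huy : u ≠ y := by
    rintro rfl
    exact h₂ F z u hF.rotate.rotate
  have huz : u ≠ z := by
    rintro rfl
    exact h₂ F y u hF.rotate
  have hzF : z ∉ F := hF.2.2.2.2.1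
  have hyF : y ∉ F := hF.2.2.2.1
  have hvE : v ∉ E := hE.2.2.2.1
  have hE' := hE.compl
  set E' := {t | t ∉ E ∧ t ≠ u ∧ t ≠ v ∧ t ≠ w} with hE'def
  have hcov : ∀ t, t ∈ E ∨ t ∈ E' ∨ t = u ∨ t = v ∨ t = w := by
    intro t
    simp only [hE'def, Set.mem_ofPred_eq]
    tauto
  have hdisj : ∀ t ∈ E, t ∉ E' := fun t ht ht' => ht'.1 ht
  have hvE' : v ∉ E' := hE'.2.2.2.1
  have hwE' : w ∉ E' := hE'.2.2.2.2.1
  clear_value E'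
  by_cases h₁ : y ∉ E ∧ z ∉ E
  · exact .inr ⟨E ∩ F, Set.inter_subset_right, fun h => hvE h.1, v, w,
      hF.inter_of_notMem h₂ hE hv h₁.1 h₁.2⟩
  by_cases h₁' : y ∉ E' ∧ z ∉ E'
  · exact .inr ⟨E' ∩ F, Set.inter_subset_right, fun h => hvE' h.1, v, w,
      hF.inter_of_notMem h₂ hE' hv h₁'.1 h₁'.2⟩
  have hsep : ∀ {y z : V} {E E' : Set V}, IsFragment G F u y z → IsFragment G E u v w →
      IsFragment G E' u v w → (∀ t, t ∈ E ∨ t ∈ E' ∨ t = u ∨ t = v ∨ t = w) →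
      y ∈ E → z ∈ E' → y ∉ E' → z ∉ E →
      F = {v} ∨ ∃ F' ⊆ F, v ∉ F' ∧ ∃ q r, IsFragment G F' u q r := by
    intro y z E E' hF hE hE' hcov hy hz hyE' hzE
    have hyw : y ≠ w := fun h => hE.2.2.2.2.1 (h ▸ hy)
    have hzw : z ≠ w := fun h => hE'.2.2.2.2.1 (h ▸ hz)
    have hvE : v ∉ E := hE.2.2.2.1
    have hvE' : v ∉ E' := hE'.2.2.2.1
    have hFswap : IsFragment G F u z y := by
      obtain ⟨h, ⟨t, ht⟩, _, _, _, hN⟩ := hF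
      exact ⟨h, ⟨t, by grind⟩, by grind, by grind, by grind, by grind⟩
    have huF : u ∉ F := hF.2.2.1
    rcases hF.crossing h₂ hE hv hy hzE hzw with ⟨hw, hc⟩ | ⟨hw, hc⟩
    · rcases hFswap.crossing h₂ hE' hv hz hyE' hyw with ⟨-, hc'⟩ | ⟨hw', -⟩
      · by_cases hn : ∃ t ∈ E, t ∈ F
        · obtain ⟨t, ht, htF⟩ := hn
          exact .inr ⟨E ∩ F, Set.inter_subset_right, fun h => hvE h.1, v, y, hc t ht htF⟩
        by_cases hn' : ∃ t ∈ E', t ∈ F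
        · obtain ⟨t, ht, htF⟩ := hn'
          exact .inr ⟨E' ∩ F, Set.inter_subset_right, fun h => hvE' h.1, v, z, hc' t ht htF⟩
        left
        ext t
        have := hcov t
        grind
      · exact absurd hw' hw
    · rcases hFswap.crossing h₂ hE' hv hz hyE' hyw with ⟨hw', -⟩ | ⟨-, hc'⟩
      · exact absurd hw hw'
      · obtain ⟨-, ⟨t, ht⟩, -⟩ := hF
        have := hcov t
        grind
  have hFswap : IsFragment G F u z y := by
    obtain ⟨h, ⟨t, ht⟩, _, _, _, hN⟩ := hF
    exact ⟨h, ⟨t, by grind⟩, by grind, by grind, by grind, by grind⟩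
  have := hdisj y
  have := hdisj z
  by_cases hy : y ∈ E
  · exact hsep hF hE hE' hcov hy (by grind) (by grind) (by grind)
  · exact hsep hFswap hE hE' hcov (by grind) (by grind) (by grind) (by grind)

/-! ### Vertices incident with no contractible edge -/

/-- `v` is a neighbour of `u` with at most two further neighbours. -/
def IsCubicNeighbor (G : SimpleGraph V) (u v : V) : Prop :=
  G.Adj u v ∧ ∃ p q, ∀ t, G.Adj v t → t = u ∨ t = p ∨ t = q

theorem IsFragment.exists_isCubicNeighbor [Finite V] {G : SimpleGraph V}
    (h₂ : ∀ (F : Set V) (p q : V), ¬ IsFragment G F p q q) {u : V}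
    (hu : ∀ v, G.Adj u v → ∃ w E, IsFragment G E u v w) {F : Set V} {y z : V}
    (hF : IsFragment G F u y z) : ∃ v ∈ F, IsCubicNeighbor G u v := by
  induction hn : F.ncard using Nat.strong_induction_on generalizing F y z with
  | _ n ih =>
    obtain ⟨v, hv, huv⟩ := hF.exists_adj_mem h₂
    obtain ⟨w, E, hE⟩ := hu v huv
    rcases hF.eq_singleton_or_exists_subset h₂ hE hv with rfl | ⟨F', hF'F, hvF', q, r, hF'⟩
    · refine ⟨v, rfl, huv, y, z, fun t ht => ?_⟩
      rcases hF.2.2.2.2.2 v rfl t ht with h | h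
      · exact absurd (h ▸ ht) G.irrefl
      · exact h
    · have hlt : F'.ncard < n := hn ▸ Set.ncard_lt_ncard
        ((Set.ssubset_iff_of_subset hF'F).2 ⟨v, hv, hvF'⟩) (Set.toFinite F)
      obtain ⟨x, hx, hc⟩ := ih _ hlt hF' rfl
      exact ⟨x, hF'F hx, hc⟩

theorem IsFragment.eq_singleton_or_exists_isCubicNeighbor [Finite V] {G : SimpleGraph V}
    (h₂ : ∀ (F : Set V) (p q : V), ¬ IsFragment G F p q q) {u : V}
    (hu : ∀ v, G.Adj u v → ∃ w E, IsFragment G E u v w) {F : Set V} {y z v : V}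
    (hF : IsFragment G F u y z) (hv : v ∈ F) (huv : G.Adj u v) :
    F = {v} ∨ ∃ x ∈ F, x ≠ v ∧ IsCubicNeighbor G u x := by
  obtain ⟨w, E, hE⟩ := hu v huv
  rcases hF.eq_singleton_or_exists_subset h₂ hE hv with h | ⟨F', hF'F, hvF', q, r, hF'⟩
  · exact .inl h
  · obtain ⟨x, hx, hc⟩ := hF'.exists_isCubicNeighbor h₂ hu
    exact .inr ⟨x, hF'F hx, fun h => hvF' (h ▸ hx), hc⟩

/-- In a 3-connected graph, a vertex incident with no contractible edge has at least four
cubic neighbours. -/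
theorem exists_four_isCubicNeighbor [Finite V] {G : SimpleGraph V}
    (h₂ : ∀ (F : Set V) (p q : V), ¬ IsFragment G F p q q) {u : V}
    (hne : ∃ v, G.Adj u v)
    (hu : ∀ v, G.Adj u v → ∃ w E, IsFragment G E u v w) :
    ∃ x : Fin 4 → V, Function.Injective x ∧ ∀ i, IsCubicNeighbor G u (x i) := by
  have key : ∀ x₀ x₁ x₂ x₃ : V, x₀ ≠ x₁ → x₀ ≠ x₂ → x₀ ≠ x₃ → x₁ ≠ x₂ → x₁ ≠ x₃ → x₂ ≠ x₃ →
      IsCubicNeighbor G u x₀ → IsCubicNeighbor G u x₁ → IsCubicNeighbor G u x₂ →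
      IsCubicNeighbor G u x₃ →
      ∃ x : Fin 4 → V, Function.Injective x ∧ ∀ i, IsCubicNeighbor G u (x i) := by
    intro x₀ x₁ x₂ x₃ h₀₁ h₀₂ h₀₃ h₁₂ h₁₃ h₂₃ c₀ c₁ c₂ c₃
    refine ⟨![x₀, x₁, x₂, x₃], ?_, ?_⟩
    · intro i j hij
      fin_cases i <;> fin_cases j <;> simp_all
    · intro i
      fin_cases i <;> assumption
  obtain ⟨v', hv'⟩ := hne
  obtain ⟨w', F, hF⟩ := hu v' hv'
  obtain ⟨v, -, hv⟩ := hF.exists_isCubicNeighbor h₂ hu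
  obtain ⟨w, D, hD⟩ := hu v hv.1
  have hD' := hD.compl
  obtain ⟨v₁, hv₁D, hv₁⟩ := hD.exists_isCubicNeighbor h₂ hu
  obtain ⟨v₂, hv₂D, hv₂⟩ := hD'.exists_isCubicNeighbor h₂ hu
  have hvD := hD.2.2.2.1
  have hvD' := hD'.2.2.2.1
  rcases hD.eq_singleton_or_exists_isCubicNeighbor h₂ hu hv₁D hv₁.1 with hs | ⟨x, hx, hxv, hxc⟩
  · rcases hD'.eq_singleton_or_exists_isCubicNeighbor h₂ hu hv₂D hv₂.1 with
      hs' | ⟨x, hx, hxv, hxc⟩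
    · obtain ⟨t, htD, hvt⟩ := hD.rotate.exists_adj_mem h₂
      obtain ⟨t', htD', hvt'⟩ := hD'.rotate.exists_adj_mem h₂
      have hall : ∀ t, t = v₁ ∨ t = v₂ ∨ t = u ∨ t = v ∨ t = w := by
        intro t
        have h : t ∈ D ∨ t ∈ {t | t ∉ D ∧ t ≠ u ∧ t ≠ v ∧ t ≠ w} ∨ t = u ∨ t = v ∨ t = w := by
          simp only [Set.mem_ofPred_eq]
          tauto
        rw [hs', hs] at h
        simpa using h
      rw [hs] at htD
      rw [hs'] at htD'
      obtain rfl : t = v₁ := htD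
      obtain rfl : t' = v₂ := htD'
      have hwv : v ≠ w := by
        rintro rfl
        exact h₂ _ _ _ hD
      have hwu : u ≠ w := by
        rintro rfl
        exact h₂ _ _ _ hD.rotate
      have hne : t ≠ t' := by grind
      have hnadj : ¬ G.Adj w v := by
        intro h
        obtain ⟨_, p, q, hpq⟩ := hv
        have h₁ := hpq _ hvt
        have h₂ := hpq _ hvt'
        have h₃ := hpq _ h.symm
        have := hv₁.1.ne
        have := hv₂.1.ne
        have := hD.2.2.2.2.1
        have := hD'.2.2.2.2.1
        grind
      have hwadj : ∀ s, G.Adj w s → s = u ∨ s = t ∨ s = t' := by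
        intro s hs
        have := hall s
        have := hs.ne
        grind
      have huw : G.Adj u w := by
        by_contra h
        have := hv₁.1.ne
        have := hv₂.1.ne
        have := hD.2.2.2.2.1
        have := hD'.2.2.2.2.1
        refine h₂ {w} t t' ⟨⟨w, rfl⟩, ⟨u, by grind⟩, by grind, by grind, by grind, ?_⟩
        rintro _ rfl s hs
        have := hwadj s hs
        have := hs.symm
        grind
      have := hD.2.2.2.2.1
      have := hD'.2.2.2.2.1
      exact key v w t t' (by grind) (by grind) (by grind) (by grind) (by grind) (by grind)
        hv ⟨huw, t, t', hwadj⟩ hv₁ hv₂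
    · exact key v v₁ v₂ x (by grind) (by grind) (by grind) (by grind) (by grind) (by grind)
        hv hv₁ hv₂ hxc
  · exact key v v₁ v₂ x (by grind) (by grind) (by grind) (by grind) (by grind) (by grind)
      hv hv₁ hv₂ hxc

/-! ### Contracting an edge -/

open Classical in
/-- The map identifying `y` with `x`. -/
noncomputable def identify {x y : V} (hxy : x ≠ y) (t : V) : {t : V // t ≠ y} :=
  if h : t = y then ⟨x, hxy⟩ else ⟨t, h⟩

theorem identify_of_ne {x y t : V} (hxy : x ≠ y) (h : t ≠ y) : identify hxy t = ⟨t, h⟩ := by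
  simp [identify, h]

theorem identify_self {x y : V} (hxy : x ≠ y) : identify hxy y = ⟨x, hxy⟩ := by
  simp [identify]

theorem identify_eq_iff {x y s t : V} (hxy : x ≠ y) :
    identify hxy s = identify hxy t ↔ s = t ∨ (s = x ∨ s = y) ∧ (t = x ∨ t = y) := by
  by_cases hs : s = y <;> by_cases ht : t = y <;>
    simp [identify, hs, ht] <;> grind

theorem identify_surjective {x y : V} (hxy : x ≠ y) : Function.Surjective (identify hxy) :=
  fun t => ⟨t, identify_of_ne hxy t.2⟩

/-- The graph obtained by contracting `xy` to `x`. -/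
def contract (G : SimpleGraph V) {x y : V} (hxy : x ≠ y) : SimpleGraph {t : V // t ≠ y} where
  Adj p q := p ≠ q ∧ ∃ s t, identify hxy s = p ∧ identify hxy t = q ∧ G.Adj s t
  symm := ⟨fun _ _ ⟨h, s, t, hs, ht, hst⟩ => ⟨h.symm, t, s, ht, hs, hst.symm⟩⟩
  loopless := ⟨fun _ h => h.1 rfl⟩

theorem preimage_connected_of_contract {G : SimpleGraph V} {x y : V} (hxy : G.Adj x y)
    {A : Set {t : V // t ≠ y}} (hA : ((contract G hxy.ne).induce A).Connected) :
    (G.induce (identify hxy.ne ⁻¹' A)).Connected := by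
  rw [induce_connected_iff] at hA ⊢
  obtain ⟨⟨a, ha⟩, hA⟩ := hA
  refine ⟨?_, ?_⟩
  · obtain ⟨s, rfl⟩ := identify_surjective hxy.ne a
    exact ⟨s, ha⟩
  · rintro P ⟨s, hsA, hsP⟩ hP t htA
    have hfib : ∀ p q, identify hxy.ne p = identify hxy.ne q → identify hxy.ne p ∈ A →
        p ∈ P → q ∈ P := by
      intro p q hpq hpA hp
      rcases (identify_eq_iff hxy.ne).1 hpq with rfl | ⟨h₁, h₂⟩
      · exact hp
      · have h := hP p hpA hp q (by rw [Set.mem_preimage, ← hpq]; exact hpA)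
        have := hxy.symm
        grind
    obtain ⟨t', ht', htP⟩ := hA (identify hxy.ne '' P) ⟨_, hsA, s, hsP, rfl⟩ (by
      rintro _ hpA ⟨p, hp, rfl⟩ _ hqA ⟨-, p', q, hp', rfl, hadj⟩
      refine ⟨q, hP p' (by rw [Set.mem_preimage, hp']; exact hpA) ?_ q hqA hadj, rfl⟩
      exact hfib p p' hp'.symm hpA hp) _ htA
    exact hfib t' t htP (by rw [htP]; exact htA) ht'

theorem IsModel.of_contract {G : SimpleGraph V} {x y : V} (hxy : G.Adj x y) {W : Type*}
    {H : SimpleGraph W} {B : W → Set {t : V // t ≠ y}} (h : IsModel (contract G hxy.ne) H B) :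
    IsModel G H fun i => identify hxy.ne ⁻¹' B i where
  connected i := preimage_connected_of_contract hxy (h.connected i)
  disjoint i j hij := (h.disjoint i j hij).preimage _
  adj_of_adj i j hij := by
    obtain ⟨_, hu, _, hv, -, s, t, rfl, rfl, hst⟩ := h.adj_of_adj hij
    exact ⟨s, hu, t, hv, hst⟩

theorem KConnected.contract [Fintype V] {G : SimpleGraph V} (hG : KConnected G 3)
    (hcard : 5 ≤ Fintype.card V) {x y : V} (hxy : G.Adj x y) [Fintype {t : V // t ≠ y}]
    (hno : ∀ z F, ¬ IsFragment G F x y z) : KConnected (contract G hxy.ne) 3 := by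
  have hc : Fintype.card {t : V // t ≠ y} = Fintype.card V - 1 := by
    classical
    simp
  refine ⟨by omega, fun S hS => ?_⟩
  rw [induce_connected_iff]
  refine ⟨?_, ?_⟩
  · rw [Set.nonempty_compl]
    rintro rfl
    rw [Set.ncard_univ, Nat.card_eq_fintype_card] at hS
    omega
  rintro P ⟨s, hsS, hsP⟩ hP t htS
  by_contra htP
  have hclosed : ∀ p q, G.Adj p q → identify hxy.ne p ∉ S → identify hxy.ne p ∈ P →
      identify hxy.ne q ∉ S → identify hxy.ne q ∈ P := by
    intro p q hpq hpS hpP hqS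
    by_cases h : identify hxy.ne p = identify hxy.ne q
    · exact h ▸ hpP
    · exact hP _ hpS hpP _ hqS ⟨h, p, q, rfl, rfl, hpq⟩
  obtain ⟨s, rfl⟩ := identify_surjective hxy.ne s
  obtain ⟨t, rfl⟩ := identify_surjective hxy.ne t
  by_cases hx : (⟨x, hxy.ne⟩ : {t : V // t ≠ y}) ∈ S
  · have hle : (S \ {⟨x, hxy.ne⟩}).ncard ≤ 1 := by
      have := Set.ncard_sdiff_singleton_add_one hx (Set.toFinite S)
      omega
    have hz : ∃ z : {t : V // t ≠ y}, z ∈ S ∧ ∀ p ∈ S, p = ⟨x, hxy.ne⟩ ∨ p = z := by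
      rcases Set.ncard_le_one_iff_eq (Set.toFinite _) |>.1 hle with h | ⟨z, h⟩
      · refine ⟨_, hx, fun p hp => ?_⟩
        by_contra! hpx
        exact (Set.ext_iff.1 h p).1 ⟨hp, hpx.1⟩
      · refine ⟨z, ((Set.ext_iff.1 h z).2 rfl).1, fun p hp => ?_⟩
        by_contra! hpx
        exact hpx.2 ((Set.ext_iff.1 h p).1 ⟨hp, hpx.1⟩)
    obtain ⟨z, hzS, hz⟩ := hz
    have hSx : identify hxy.ne x ∈ S := by rwa [identify_of_ne hxy.ne hxy.ne]
    have hSy : identify hxy.ne y ∈ S := by rwa [identify_self]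
    have hSz : identify hxy.ne z ∈ S := by rwa [identify_of_ne hxy.ne z.2]
    have hmem : ∀ p, identify hxy.ne p ∈ S → p = x ∨ p = y ∨ p = z := by
      intro p hp
      by_cases hpy : p = y
      · exact .inr (.inl hpy)
      · rcases hz _ hp with h | h <;> rw [identify_of_ne hxy.ne hpy] at h
        · exact .inl (congrArg Subtype.val h)
        · exact .inr (.inr (congrArg Subtype.val h))
    refine hno z {p | identify hxy.ne p ∉ S ∧ identify hxy.ne p ∈ P}
      ⟨⟨s, hsS, hsP⟩, ⟨t, fun h => htP h.2, ?_, ?_, ?_⟩, fun h => h.1 hSx, fun h => h.1 hSy,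
        fun h => h.1 hSz, fun p hp q hpq => ?_⟩
    · rintro rfl; exact htS hSx
    · rintro rfl; exact htS hSy
    · rintro rfl; exact htS hSz
    · by_cases hq : identify hxy.ne q ∈ S
      · exact .inr (hmem q hq)
      · exact .inl ⟨hq, hclosed p q hpq hp.1 hp.2 hq⟩
  · have hSmem : ∀ p, p ∈ Subtype.val '' S ↔ identify hxy.ne p ∈ S := by
      intro p
      by_cases hpy : p = y
      · subst hpy
        rw [identify_self]
        simp [hx]
      · rw [identify_of_ne hxy.ne hpy]
        simp [hpy]
    have hlt : (Subtype.val '' S).ncard < 3 := by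
      rwa [Set.ncard_image_of_injective _ Subtype.val_injective]
    refine htP (((induce_connected_iff G _).1 (hG.2 _ hlt)).2
      (identify hxy.ne ⁻¹' P) ⟨s, ?_, hsP⟩ ?_ t ?_)
    · rwa [Set.mem_compl_iff, hSmem]
    · intro p hpS hpP q hqS hpq
      rw [Set.mem_compl_iff, hSmem] at hpS hqS
      exact hclosed p q hpq hpS hpP hqS
    · rwa [Set.mem_compl_iff, hSmem]

/-! ### Explicit rooted models -/

theorem isModel_W4_of_rim {G : SimpleGraph V} {p q r s h : V} (hpq : G.Adj p q)
    (hqr : G.Adj q r) (hrs : G.Adj r s) (hsp : G.Adj s p) (hpr : p ≠ r) (hqs : q ≠ s)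
    (hp : G.Adj h p) (hq : G.Adj h q) (hr : G.Adj h r) (hs : G.Adj h s) :
    IsModel G W4 ![{p}, {q}, {r}, {s}, {h}] where
  connected i := by
    fin_cases i <;> exact induce_singleton_connected G _
  disjoint i j hij := by
    have := hpq.ne
    have := hqr.ne
    have := hrs.ne
    have := hsp.ne
    have := hp.ne
    have := hq.ne
    have := hr.ne
    have := hs.ne
    fin_cases i <;> fin_cases j <;> simp at hij ⊢ <;> grind
  adj_of_adj i j hij := by
    fin_cases i <;> fin_cases j <;> simp [W4] at hij ⊢ <;>
      first | assumption | (apply SimpleGraph.Adj.symm; assumption)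

theorem hasK4XMinor_of_complete {G : SimpleGraph V} {a b c d : V} (hab : G.Adj a b)
    (hac : G.Adj a c) (had : G.Adj a d) (hbc : G.Adj b c) (hbd : G.Adj b d) (hcd : G.Adj c d) :
    HasK4XMinor G a b c d := by
  refine ⟨![{a}, {b}, {c}, {d}], id, Function.injective_id, ⟨?_, ?_, ?_⟩, rfl, rfl, rfl, rfl⟩
  · intro i
    fin_cases i <;> exact induce_singleton_connected G _
  · intro i j hij
    have := hab.ne
    have := hac.ne
    have := had.ne
    have := hbc.ne
    have := hbd.ne
    have := hcd.ne
    fin_cases i <;> fin_cases j <;> simp at hij ⊢ <;> grind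
  · intro i j hij
    fin_cases i <;> fin_cases j <;> simp at hij ⊢ <;>
      first | assumption | (apply SimpleGraph.Adj.symm; assumption)

theorem hasK4XMinor_of_three_hubs {G : SimpleGraph V} {a b c d u₁ u₂ u₃ : V}
    (hab : a ≠ b) (hac : a ≠ c) (had : a ≠ d) (hbc : b ≠ c) (hbd : b ≠ d) (hcd : c ≠ d)
    (h₁₂ : u₁ ≠ u₂) (h₁₃ : u₁ ≠ u₃) (h₂₃ : u₂ ≠ u₃)
    (h : ∀ u ∈ ({u₁, u₂, u₃} : Set V), ∀ x ∈ ({a, b, c, d} : Set V), G.Adj u x) :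
    HasK4XMinor G a b c d := by
  have h' : ∀ u ∈ ({u₁, u₂, u₃} : Set V), ∀ x ∈ ({a, b, c, d} : Set V), G.Adj x u :=
    fun u hu x hx => (h u hu x hx).symm
  have hne : ∀ u ∈ ({u₁, u₂, u₃} : Set V), ∀ x ∈ ({a, b, c, d} : Set V), x ≠ u :=
    fun u hu x hx => (h' u hu x hx).ne
  simp only [Set.mem_insert_iff, Set.mem_singleton_iff, forall_eq_or_imp, forall_eq] at h h' hne
  refine ⟨![{a}, {b, u₁}, {c, u₂}, {d, u₃}], id, Function.injective_id, ⟨?_, ?_, ?_⟩,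
    by simp, by simp, by simp, by simp⟩
  · intro i
    fin_cases i
    · exact induce_singleton_connected G _
    all_goals exact induce_pair_connected_of_adj (by tauto)
  · intro i j hij
    fin_cases i <;> fin_cases j <;> simp at hij ⊢ <;> grind
  · intro i j hij
    fin_cases i <;> fin_cases j <;> simp at hij ⊢ <;> tauto

/-! ### Roots all of whose outside vertices are hubs -/

theorem IsCubicNeighbor.adj_pattern {G : SimpleGraph V}
    (h₂ : ∀ (F : Set V) (p q : V), ¬ IsFragment G F p q q) {u x y z w : V}
    (hall : ∀ t, t = x ∨ t = y ∨ t = z ∨ t = w ∨ t = u) (hxy : x ≠ y) (hxz : x ≠ z)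
    (hxw : x ≠ w) (hyz : y ≠ z) (hyw : y ≠ w) (hzw : z ≠ w) (hy : u ≠ y) (hz : u ≠ z)
    (hw : u ≠ w) (hc : IsCubicNeighbor G u x) :
    G.Adj x y ∧ G.Adj x z ∧ ¬ G.Adj x w ∨ G.Adj x y ∧ ¬ G.Adj x z ∧ G.Adj x w ∨
      ¬ G.Adj x y ∧ G.Adj x z ∧ G.Adj x w := by
  obtain ⟨hux, p, q, hpq⟩ := hc
  have hnot : ¬ (G.Adj x y ∧ G.Adj x z ∧ G.Adj x w) := by
    rintro ⟨h₁, h₂, h₃⟩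
    have := hpq _ h₁
    have := hpq _ h₂
    have := hpq _ h₃
    grind
  have hne := hux.ne
  have hone : ∀ v v', v ≠ v' → v ≠ x → v' ≠ x → v ≠ u → v' ≠ u →
      G.Adj x v ∨ G.Adj x v' := by
    intro v v' hvv' hv hv' hvu hv'u
    by_contra! hno
    obtain ⟨r, hr⟩ : ∃ r, (r = y ∨ r = z ∨ r = w) ∧ r ≠ v ∧ r ≠ v' := by
      by_contra! hcon
      have := hcon y
      have := hcon z
      have := hcon w
      by_cases y = v <;> by_cases z = v <;> by_cases w = v <;> grind
    refine h₂ {x} u r ⟨⟨x, rfl⟩, ⟨v, by grind⟩, by grind, by grind, by grind, ?_⟩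
    rintro _ rfl t ht
    have := hall t
    have := hall v
    have := hall v'
    have := ht.ne
    grind
  have := hone y z
  have := hone y w
  have := hone z w
  grind

/-- A 2-regular graph on four vertices is a 4-cycle. -/
theorem four_cycle_of_pattern {ab ac ad bc bd cd : Prop}
    (pa : ab ∧ ac ∧ ¬ ad ∨ ab ∧ ¬ ac ∧ ad ∨ ¬ ab ∧ ac ∧ ad)
    (pb : ab ∧ bc ∧ ¬ bd ∨ ab ∧ ¬ bc ∧ bd ∨ ¬ ab ∧ bc ∧ bd)
    (pc : ac ∧ bc ∧ ¬ cd ∨ ac ∧ ¬ bc ∧ cd ∨ ¬ ac ∧ bc ∧ cd)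
    (pd : ad ∧ bd ∧ ¬ cd ∨ ad ∧ ¬ bd ∧ cd ∨ ¬ ad ∧ bd ∧ cd) :
    (ac ∧ bc ∧ bd ∧ ad) ∨ (ab ∧ bc ∧ cd ∧ ad) ∨ (ab ∧ bd ∧ cd ∧ ac) := by
  by_cases ab <;> by_cases ac <;> by_cases ad <;> by_cases bc <;> by_cases bd <;> simp_all

theorem hasW4XMinor_of_hub {G : SimpleGraph V}
    (h₂ : ∀ (F : Set V) (p q : V), ¬ IsFragment G F p q q)
    {a b c d u : V} (hab : a ≠ b) (hac : a ≠ c) (had : a ≠ d) (hbc : b ≠ c) (hbd : b ≠ d)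
    (hcd : c ≠ d) (hall : ∀ t, t = a ∨ t = b ∨ t = c ∨ t = d ∨ t = u)
    (ha : IsCubicNeighbor G u a) (hb : IsCubicNeighbor G u b) (hc : IsCubicNeighbor G u c)
    (hd : IsCubicNeighbor G u d) : HasW4XMinor G a b c d := by
  have hua := ha.1
  have hub := hb.1
  have huc := hc.1
  have hud := hd.1
  have pa := ha.adj_pattern h₂ hall hab hac had hbc hbd hcd hub.ne huc.ne hud.ne
  have pb := hb.adj_pattern h₂ (x := b) (y := a) (z := c) (w := d)
    (fun t => by have := hall t; grind) hab.symm hbc hbd hac had hcd hua.ne huc.ne hud.ne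
  have pc := hc.adj_pattern h₂ (x := c) (y := a) (z := b) (w := d)
    (fun t => by have := hall t; grind) hac.symm hbc.symm hcd hab had hbd hua.ne hub.ne hud.ne
  have pd := hd.adj_pattern h₂ (x := d) (y := a) (z := b) (w := c)
    (fun t => by have := hall t; grind) had.symm hbd.symm hcd.symm hab hac hbc
    hua.ne hub.ne huc.ne
  rw [G.adj_comm b a] at pb
  rw [G.adj_comm c a, G.adj_comm c b] at pc
  rw [G.adj_comm d a, G.adj_comm d b, G.adj_comm d c] at pd
  have hcases : (G.Adj a c ∧ G.Adj b c ∧ G.Adj b d ∧ G.Adj a d) ∨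
      (G.Adj a b ∧ G.Adj b c ∧ G.Adj c d ∧ G.Adj a d) ∨
      (G.Adj a b ∧ G.Adj b d ∧ G.Adj c d ∧ G.Adj a c) :=
    four_cycle_of_pattern pa pb pc pd
  rcases hcases with ⟨h₁, h₂, h₃, h₄⟩ | ⟨h₁, h₂, h₃, h₄⟩ | ⟨h₁, h₂, h₃, h₄⟩
  · exact ⟨![{a}, {c}, {b}, {d}, {u}], ![0, 2, 1, 3], by decide, by decide,
      isModel_W4_of_rim h₁ h₂.symm h₃ h₄.symm hab hcd hua huc hub hud,
      by simp, by simp, by simp, by simp⟩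
  · exact ⟨![{a}, {b}, {c}, {d}, {u}], ![0, 1, 2, 3], by decide, by decide,
      isModel_W4_of_rim h₁ h₂ h₃ h₄.symm hac hbd hua hub huc hud,
      by simp, by simp, by simp, by simp⟩
  · exact ⟨![{a}, {b}, {d}, {c}, {u}], ![0, 1, 3, 2], by decide, by decide,
      isModel_W4_of_rim h₁ h₂ h₃.symm h₄.symm had hbc hua hub hud huc,
      by simp, by simp, by simp, by simp⟩

theorem not_forall_isCubicNeighbor_of_two_hubs {G : SimpleGraph V}
    (h₂ : ∀ (F : Set V) (p q : V), ¬ IsFragment G F p q q)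
    {a b c d u₁ u₂ : V} (hab : a ≠ b) (hac : a ≠ c) (had : a ≠ d) (hbc : b ≠ c)
    (hu : u₁ ≠ u₂) (hall : ∀ t, t ∈ ({a, b, c, d} : Set V) ∨ t = u₁ ∨ t = u₂)
    (h₁ : ∀ x ∈ ({a, b, c, d} : Set V), IsCubicNeighbor G u₁ x)
    (h₁' : ∀ x ∈ ({a, b, c, d} : Set V), IsCubicNeighbor G u₂ x) : False := by
  have hX : ∀ x ∈ ({a, b, c, d} : Set V), x ≠ u₁ ∧ x ≠ u₂ ∧
      ∃ p, ∀ t, G.Adj x t → t = u₁ ∨ t = u₂ ∨ t = p := by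
    intro x hx
    obtain ⟨hux, p, q, hpq⟩ := h₁ x hx
    have hux' := (h₁' x hx).1
    refine ⟨hux.ne', hux'.ne', ?_⟩
    rcases hpq u₂ hux'.symm with h | rfl | rfl
    · exact absurd h.symm hu
    · exact ⟨q, hpq⟩
    · exact ⟨p, fun t ht => by have := hpq t ht; tauto⟩
  obtain ⟨ha₁, ha₂, p, hp⟩ := hX a (by simp)
  have hb := hX b (by simp)
  have hc := hX c (by simp)
  have hd := hX d (by simp)
  by_cases hex : ∃ t, G.Adj a t ∧ t ≠ u₁ ∧ t ≠ u₂
  · obtain ⟨t, hat, ht₁, ht₂⟩ := hex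
    obtain ⟨-, -, q, hq⟩ := hX t ((hall t).resolve_right (by tauto))
    obtain ⟨s, hs⟩ : ∃ s, s ≠ a ∧ s ≠ t ∧ s ≠ u₁ ∧ s ≠ u₂ := by
      by_cases htb : b = t
      · exact ⟨c, by grind⟩
      · exact ⟨b, by grind⟩
    refine h₂ {a, t} u₁ u₂ ⟨⟨a, by simp⟩, ⟨s, by grind⟩, by grind, by grind, by grind, ?_⟩
    intro x hx y hxy
    have := hp t hat
    have := hq a hat.symm
    rcases hx with rfl | rfl
    · have := hp y hxy
      grind
    · have := hq y hxy
      grind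
  · refine h₂ {a} u₁ u₂ ⟨⟨a, rfl⟩, ⟨b, by grind⟩, by grind, by grind, by grind, ?_⟩
    rintro _ rfl y hxy
    grind

/-- If every vertex outside `X = {a, b, c, d}` is adjacent to every vertex of `X`, and the
vertices of `X` are cubic, then the required minor exists. -/
theorem hasK4XMinor_or_hasW4XMinor_of_forall_isCubicNeighbor {G : SimpleGraph V}
    (h₂ : ∀ (F : Set V) (p q : V), ¬ IsFragment G F p q q)
    {a b c d : V} (hab : a ≠ b) (hac : a ≠ c) (had : a ≠ d) (hbc : b ≠ c) (hbd : b ≠ d)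
    (hcd : c ≠ d) {u₁ : V} (hu₁ : u₁ ∉ ({a, b, c, d} : Set V))
    (h : ∀ u, u ∉ ({a, b, c, d} : Set V) → ∀ x ∈ ({a, b, c, d} : Set V),
      IsCubicNeighbor G u x) :
    HasK4XMinor G a b c d ∨ HasW4XMinor G a b c d := by
  by_cases hall : ∃ u₂, u₂ ∉ ({a, b, c, d} : Set V) ∧ u₂ ≠ u₁
  · obtain ⟨u₂, hu₂, h₂₁⟩ := hall
    by_cases hall : ∃ u₃, u₃ ∉ ({a, b, c, d} : Set V) ∧ u₃ ≠ u₁ ∧ u₃ ≠ u₂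
    · obtain ⟨u₃, hu₃, h₃₁, h₃₂⟩ := hall
      refine .inl (hasK4XMinor_of_three_hubs hab hac had hbc hbd hcd h₂₁.symm h₃₁.symm h₃₂.symm
        fun u hu x hx => (h u ?_ x hx).1)
      rcases hu with rfl | rfl | rfl <;> assumption
    · exact (not_forall_isCubicNeighbor_of_two_hubs h₂ hab hac had hbc h₂₁.symm
        (fun t => by by_contra! hcon; exact hall ⟨t, hcon⟩) (h u₁ hu₁) (h u₂ hu₂)).elim
  · refine .inr (hasW4XMinor_of_hub h₂ hab hac had hbc hbd hcd (u := u₁) (fun t => ?_)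
      (h u₁ hu₁ a (by simp)) (h u₁ hu₁ b (by simp)) (h u₁ hu₁ c (by simp))
      (h u₁ hu₁ d (by simp)))
    by_contra! hcon
    exact hall ⟨t, by simp [hcon], hcon.2.2.2.2⟩

/-! ### The theorem without planarity -/

theorem exists_ne_of_three_lt_card [Fintype V] (h : 3 < Fintype.card V) (p q r : V) :
    ∃ t, t ≠ p ∧ t ≠ q ∧ t ≠ r := by
  classical
  obtain ⟨t, -, ht⟩ := Finset.exists_mem_notMem_of_card_lt_card (s := {p, q, r})
    (t := (Finset.univ : Finset V)) (lt_of_le_of_lt Finset.card_le_three h)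
  exact ⟨t, by simpa using ht⟩

/-- If no edge with an end outside `{a, b, c, d}` is contractible, then the minor exists. -/
theorem hasK4XMinor_or_hasW4XMinor_of_forall_isFragment [Fintype V] {G : SimpleGraph V}
    (h₂ : ∀ (F : Set V) (p q : V), ¬ IsFragment G F p q q) (hcard : 5 ≤ Fintype.card V)
    {a b c d : V} (hab : a ≠ b) (hac : a ≠ c) (had : a ≠ d) (hbc : b ≠ c) (hbd : b ≠ d)
    (hcd : c ≠ d)
    (hno : ∀ u, u ∉ ({a, b, c, d} : Set V) → ∀ v, G.Adj u v → ∃ w E, IsFragment G E u v w) :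
    HasK4XMinor G a b c d ∨ HasW4XMinor G a b c d := by
  classical
  have hfour : ∀ u, u ∉ ({a, b, c, d} : Set V) →
      ∃ x : Fin 4 → V, Function.Injective x ∧ ∀ i, IsCubicNeighbor G u (x i) := by
    intro u hu
    refine exists_four_isCubicNeighbor h₂ ?_ (hno u hu)
    by_contra! hiso
    obtain ⟨p, hp, -⟩ := exists_ne_of_three_lt_card (by omega) u u u
    obtain ⟨q, hqu, hqp, -⟩ := exists_ne_of_three_lt_card (by omega) u p p
    refine h₂ {u} p p ⟨⟨u, rfl⟩, ⟨q, hqu, hqp, hqp, hqp⟩, hp, hp, hp, ?_⟩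
    rintro _ rfl t ht
    exact absurd ht (hiso t)
  have hmem : ∀ u v, IsCubicNeighbor G u v → v ∈ ({a, b, c, d} : Set V) := by
    rintro u v ⟨-, p, q, hpq⟩
    by_contra hv
    obtain ⟨x, hx, hxc⟩ := hfour v hv
    have hsub : Finset.univ.image x ⊆ {u, p, q} := by
      intro t ht
      obtain ⟨i, -, rfl⟩ := Finset.mem_image.1 ht
      have := hpq _ (hxc i).1
      simpa using this
    have h₁ := Finset.card_le_card hsub
    rw [Finset.card_image_of_injective _ hx, Finset.card_univ, Fintype.card_fin] at h₁
    have : ({u, p, q} : Finset V).card ≤ 3 := Finset.card_le_three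
    omega
  have hX : ({a, b, c, d} : Finset V).card = 4 := by
    simp [hab, hac, had, hbc, hbd, hcd]
  obtain ⟨u₁, -, hu₁⟩ := Finset.exists_mem_notMem_of_card_lt_card (s := {a, b, c, d})
    (t := (Finset.univ : Finset V)) (by rw [hX]; exact hcard)
  refine hasK4XMinor_or_hasW4XMinor_of_forall_isCubicNeighbor h₂ hab hac had hbc hbd hcd
    (u₁ := u₁) (by simpa using hu₁) fun u hu y hy => ?_
  obtain ⟨x, hx, hxc⟩ := hfour u hu
  have hsub : Finset.univ.image x ⊆ {a, b, c, d} := by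
    intro t ht
    obtain ⟨i, -, rfl⟩ := Finset.mem_image.1 ht
    simpa using hmem u _ (hxc i)
  have heq := Finset.eq_of_subset_of_card_le hsub
    (by rw [hX, Finset.card_image_of_injective _ hx, Finset.card_univ, Fintype.card_fin])
  have hy' : y ∈ ({a, b, c, d} : Finset V) := by simpa using hy
  rw [← heq] at hy'
  obtain ⟨i, -, rfl⟩ := Finset.mem_image.1 hy'
  exact hxc i

theorem KConnected.adj_of_card_eq_four [Fintype V] {G : SimpleGraph V} (hG : KConnected G 3)
    (hcard : Fintype.card V = 4) {x y : V} (hxy : x ≠ y) : G.Adj x y := by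
  classical
  by_contra hno
  obtain ⟨p, hpx, hpy, -⟩ := exists_ne_of_three_lt_card (by omega) x y y
  obtain ⟨q, hqx, hqy, hqp⟩ := exists_ne_of_three_lt_card (by omega) x y p
  have hall : ∀ t, t ∈ ({x, y, p, q} : Finset V) := by
    intro t
    rw [(Finset.card_eq_iff_eq_univ _).1 (by grind : ({x, y, p, q} : Finset V).card =
      Fintype.card V)]
    exact Finset.mem_univ t
  refine hG.not_isFragment {x} p q ⟨⟨x, rfl⟩, ⟨y, by grind⟩, by grind, by grind, by grind, ?_⟩
  rintro _ rfl t ht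
  have := hall t
  have := ht.ne
  grind

/-- Rooted minors lift along the contraction of an edge whose ends are not both roots. -/
theorem hasK4XMinor_or_hasW4XMinor_of_contract {G : SimpleGraph V} {x y : V} (hxy : G.Adj x y)
    {a b c d : V}
    (h : HasK4XMinor (contract G hxy.ne) (identify hxy.ne a) (identify hxy.ne b)
        (identify hxy.ne c) (identify hxy.ne d) ∨
      HasW4XMinor (contract G hxy.ne) (identify hxy.ne a) (identify hxy.ne b)
        (identify hxy.ne c) (identify hxy.ne d)) :
    HasK4XMinor G a b c d ∨ HasW4XMinor G a b c d := by
  rcases h with ⟨B, f, hf, hB, ha, hb, hc, hd⟩ | ⟨B, f, hf, hf', hB, ha, hb, hc, hd⟩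
  · exact .inl ⟨_, f, hf, hB.of_contract hxy, ha, hb, hc, hd⟩
  · exact .inr ⟨_, f, hf, hf', hB.of_contract hxy, ha, hb, hc, hd⟩

/-- Every 3-connected graph has a `K₄(X)`-minor or a `W₄(X)`-minor, planar or not. -/
theorem KConnected.hasK4XMinor_or_hasW4XMinor (n : ℕ) {V : Type*} [Fintype V]
    {G : SimpleGraph V} (hn : Fintype.card V = n) (hG : KConnected G 3)
    {a b c d : V} (hab : a ≠ b) (hac : a ≠ c) (had : a ≠ d) (hbc : b ≠ c) (hbd : b ≠ d)
    (hcd : c ≠ d) : HasK4XMinor G a b c d ∨ HasW4XMinor G a b c d := by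
  classical
  induction n generalizing V with
  | zero =>
    have := hG.1
    omega
  | succ n ih =>
    by_cases hcard : Fintype.card V = 4
    · have h : ∀ {x y : V}, x ≠ y → G.Adj x y := hG.adj_of_card_eq_four hcard
      exact .inl (hasK4XMinor_of_complete (h hab) (h hac) (h had) (h hbc) (h hbd) (h hcd))
    have hcard' : 5 ≤ Fintype.card V := by
      have := hG.1
      omega
    by_cases hno : ∀ u, u ∉ ({a, b, c, d} : Set V) → ∀ v, G.Adj u v →
        ∃ w E, IsFragment G E u v w
    · exact hasK4XMinor_or_hasW4XMinor_of_forall_isFragment hG.not_isFragment hcard' hab hac had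
        hbc hbd hcd hno
    push Not at hno
    obtain ⟨u, hu, v, huv, hno⟩ := hno
    simp only [Set.mem_insert_iff, Set.mem_singleton_iff, not_or] at hu
    have hroot : ∀ s t, u ≠ s → u ≠ t → s ≠ t → identify huv.ne s ≠ identify huv.ne t := by
      intro s t hs ht hst h
      rw [identify_eq_iff] at h
      grind
    obtain ⟨ha, hb, hc, hd⟩ := hu
    refine hasK4XMinor_or_hasW4XMinor_of_contract huv (ih ?_
      (hG.contract hcard' huv hno) (hroot a b ha hb hab) (hroot a c ha hc hac)
      (hroot a d ha hd had) (hroot b c hb hc hbc) (hroot b d hb hd hbd) (hroot c d hc hd hcd))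
    simp [hn]

/-- Every 3-connected planar graph with four distinct distinguished
vertices `X = {a,b,c,d}` has a `K₄(X)`-minor or a `W₄(X)`-minor. -/
theorem planar_three_connected_K4X_or_W4X
    {V : Type*} [Fintype V] (G : SimpleGraph V)
    (hG3 : KConnected G 3) (hGplanar : IsPlanar G)
    (a b c d : V) (hab : a ≠ b) (hac : a ≠ c) (had : a ≠ d) (hbc : b ≠ c) (hbd : b ≠ d)
    (hcd : c ≠ d) :
    HasK4XMinor G a b c d ∨ HasW4XMinor G a b c d := by
  exact hG3.hasK4XMinor_or_hasW4XMinor (Fintype.card V) rfl hab hac had hbc hbd hcd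

end Paper
end

section
/- Let H be a simple 2-connected graph, G a connected graph with a 1-separation (A,B) with A ∩ B = {v}, let X = {a,b,c,d} ⊆ V(G) be four distinct vertices, and let 𝓕 be a family of injective maps from X to V(H). If X ⊆ A, then G has an H(X)-minor if and only if the induced subgraph G[A] has an H(X)-minor. -/
namespace Paper

open SimpleGraph

variable {V : Type*} {U : Type*}

/-- `G` has a rooted `H(X)`-minor for `X = {r 0, r 1, r 2, r 3}` with respect to the
family `F`: here a map `π : X → V(H)` is represented by the tuple of the images of
`r 0, r 1, r 2, r 3` in this order.  So an `H(X)`-minor is an `H`-model of `G` together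
with some `π ∈ F` such that each root `r i` lies in the branch set of `π i`. -/
def HasRootedMinor (G : SimpleGraph V) {W : Type*} (H : SimpleGraph W) (r : Fin 4 → V)
    (F : Set (Fin 4 → W)) : Prop :=
  ∃ (B : W → Set V) (π : Fin 4 → W), π ∈ F ∧ IsModel G H B ∧ ∀ i, r i ∈ B (π i)

theorem _root_.SimpleGraph.Preconnected.forall_of_adj {V : Type*} {G : SimpleGraph V}
    (hG : G.Preconnected) {P : V → Prop} (hP : ∀ u w, G.Adj u w → P u → P w) {u : V} (hu : P u)
    (w : V) : P w := by
  obtain ⟨p⟩ := hG u w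
  induction p with
  | nil => exact hu
  | cons h _ ih => exact ih (hP _ _ h hu)

/-- The image of a connected vertex set is connected under a map that sends each edge to an edge
or to a single vertex. -/
theorem connected_induce_image {V V' : Type*} {G : SimpleGraph V} {G' : SimpleGraph V'}
    {f : V → V'} (hf : ∀ u w, G.Adj u w → f u = f w ∨ G'.Adj (f u) (f w)) {S : Set V}
    (hS : (G.induce S).Connected) : (G'.induce (f '' S)).Connected := by
  obtain ⟨s⟩ := hS.nonempty
  rw [connected_iff_exists_forall_reachable]
  refine ⟨⟨f s, s, s.2, rfl⟩, ?_⟩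
  rintro ⟨_, w, hw, rfl⟩
  refine hS.preconnected.forall_of_adj (u := s) (P := fun x : S =>
    (G'.induce (f '' S)).Reachable ⟨f s, s, s.2, rfl⟩ ⟨f x, x, x.2, rfl⟩)
    ?_ (Reachable.refl _) ⟨w, hw⟩
  intro x y hxy hx
  rcases hf x y hxy with h | h
  · simpa only [h] using hx
  · exact hx.trans (Adj.reachable (G := G'.induce (f '' S))
      (u := ⟨f x, x, x.2, rfl⟩) (v := ⟨f y, y, y.2, rfl⟩) h)

/-- A model can be pushed forward along a map that sends each edge to an edge or to a single
vertex, as long as the images of the branch sets stay disjoint. -/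
theorem IsModel.image {V V' W : Type*} {G : SimpleGraph V} {G' : SimpleGraph V'}
    {H : SimpleGraph W} {M : W → Set V} (hM : IsModel G H M) {f : V → V'}
    (hf : ∀ u w, G.Adj u w → f u = f w ∨ G'.Adj (f u) (f w))
    (hd : ∀ x y, x ≠ y → Disjoint (f '' M x) (f '' M y)) :
    IsModel G' H fun x => f '' M x where
  connected x := connected_induce_image hf (hM.connected x)
  disjoint := hd
  adj_of_adj x y hxy := by
    obtain ⟨u, hu, w, hw, huw⟩ := hM.adj_of_adj hxy
    have hu' := Set.mem_image_of_mem f hu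
    have hw' := Set.mem_image_of_mem f hw
    exact ⟨f u, hu', f w, hw',
      (hf u w huw).resolve_left ((hd x y hxy.ne).ne_of_mem hu' hw')⟩

section CutVertex

variable {V W : Type*} {G : SimpleGraph V} {A B : Set V} {v : V}

theorem IsSeparation.eq_of_adj (hsep : IsSeparation G A B) (hAB : A ∩ B = {v}) {u w : V}
    (huw : G.Adj u w) (hu : u ∈ A) (hw : w ∉ A) : u = v := by
  have hwB : w ∈ B := (hsep.1.ge (Set.mem_univ w)).resolve_left hw
  by_contra huv
  exact hsep.2 u w ⟨hu, fun huB => huv (hAB.le ⟨hu, huB⟩)⟩ ⟨hwB, hw⟩ huw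

theorem IsSeparation.subset_left (hsep : IsSeparation G A B) (hAB : A ∩ B = {v}) {S : Set V}
    (hS : (G.induce S).Connected) (hv : v ∉ S) {u : V} (huS : u ∈ S) (huA : u ∈ A) : S ⊆ A := by
  intro w hw
  refine hS.preconnected.forall_of_adj (u := ⟨u, huS⟩) (P := fun x : S => (x : V) ∈ A)
    ?_ huA ⟨w, hw⟩
  intro x y hxy hx
  by_contra hy
  exact hv (hsep.eq_of_adj hAB hxy hx hy ▸ x.2)

/-- In a model of a 2-connected graph, if two branch sets meet one side of a separation with
cut vertex `v`, then every branch set avoiding `v` lies on that side. -/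
theorem IsModel.subset_left [Fintype W] {H : SimpleGraph W} {M : W → Set V} (hM : IsModel G H M)
    (hH : KConnected H 2) (hsep : IsSeparation G A B) (hAB : A ∩ B = {v})
    {x y : W} (hxy : x ≠ y) (hx : (M x ∩ A).Nonempty) (hy : (M y ∩ A).Nonempty)
    {z : W} (hz : v ∉ M z) : M z ⊆ A := by
  have huniq : ∀ p q, v ∈ M p → v ∈ M q → p = q := fun p q hp hq => by
    by_contra hpq
    exact (hM.disjoint p q hpq).ne_of_mem hp hq rfl
  have hconn := hH.2 {p | v ∈ M p}
    (Nat.lt_succ_of_le ((Set.ncard_le_one (Set.toFinite _)).2 fun p hp q hq => huniq p q hp hq))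
  obtain ⟨p, hp, u, huM, huA⟩ : ∃ p, v ∉ M p ∧ (M p ∩ A).Nonempty := by
    by_cases hvx : v ∈ M x
    · exact ⟨y, fun hvy => hxy (huniq x y hvx hvy), hy⟩
    · exact ⟨x, hvx, hx⟩
  refine hconn.preconnected.forall_of_adj (u := ⟨p, hp⟩)
    (P := fun q : ({p | v ∈ M p}ᶜ : Set W) => M q ⊆ A) ?_
    (hsep.subset_left hAB (hM.connected p) hp huM huA) ⟨z, hz⟩
  intro q q' hqq' hq
  obtain ⟨s, hs, t, ht, hst⟩ := hM.adj_of_adj hqq'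
  refine hsep.subset_left hAB (hM.connected q') q'.2 ht ?_
  by_contra htA
  exact q.2 (hsep.eq_of_adj hAB hst (hq hs) htA ▸ hs)

end CutVertex

/-- Let `H` be a simple 2-connected graph, `G` a connected graph with a
1-separation `(A,B)` with `A ∩ B = {v}`, `X = {a,b,c,d}` four distinct vertices of `G`,
and `F` a family of injective maps from `X` to `V(H)`.  If `X ⊆ A`, then `G` has an
`H(X)`-minor iff `G[A]` has an `H(X)`-minor. -/
theorem cut_vertex_all_roots_one_side
    {V W : Type*} [Fintype V] [Fintype W]
    (H : SimpleGraph W) (hH2 : KConnected H 2)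
    (G : SimpleGraph V) (hGconn : G.Connected)
    (A B : Set V) (v : V) (hsep : IsSeparation G A B) (hAB : A ∩ B = {v})
    (a b c d : V) (hab : a ≠ b) (hac : a ≠ c) (had : a ≠ d) (hbc : b ≠ c) (hbd : b ≠ d)
    (hcd : c ≠ d)
    (F : Set (Fin 4 → W)) (hF : ∀ π ∈ F, Function.Injective π)
    (ha : a ∈ A) (hb : b ∈ A) (hc : c ∈ A) (hd : d ∈ A) :
    HasRootedMinor G H ![a, b, c, d] F ↔
      HasRootedMinor (G.induce A) H
        ![(⟨a, ha⟩ : A), ⟨b, hb⟩, ⟨c, hc⟩, ⟨d, hd⟩] F := by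
  classical
  have hvA : v ∈ A := (hAB.ge rfl).1
  constructor
  · rintro ⟨M, π, hπ, hM, hr⟩
    have h0 : a ∈ M (π 0) := hr 0
    have h1 : b ∈ M (π 1) := hr 1
    have hside : ∀ z, v ∉ M z → M z ⊆ A := fun z =>
      hM.subset_left hH2 hsep hAB ((hF π hπ).ne zero_ne_one) ⟨a, h0, ha⟩ ⟨b, h1, hb⟩
    let f : V → A := fun u => if hu : u ∈ A then ⟨u, hu⟩ else ⟨v, hvA⟩
    have hfA : ∀ u (hu : u ∈ A), f u = ⟨u, hu⟩ := fun u hu => dif_pos hu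
    have hfv : ∀ u, u ∉ A → f u = ⟨v, hvA⟩ := fun u hu => dif_neg hu
    have hfM : ∀ z, ∀ s ∈ f '' M z, (s : V) ∈ M z := by
      rintro z _ ⟨u, hu, rfl⟩
      by_cases huA : u ∈ A
      · rwa [hfA u huA]
      · rw [hfv u huA]
        by_contra hvz
        exact huA (hside z hvz hu)
    have hf : ∀ u w, G.Adj u w → f u = f w ∨ (G.induce A).Adj (f u) (f w) := by
      intro u w huw
      by_cases hu : u ∈ A <;> by_cases hw : w ∈ A
      · rw [hfA u hu, hfA w hw]
        exact Or.inr huw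
      · left
        rw [hfA u hu, hfv w hw]
        exact Subtype.ext (hsep.eq_of_adj hAB huw hu hw)
      · left
        rw [hfv u hu, hfA w hw]
        exact Subtype.ext (hsep.eq_of_adj hAB huw.symm hw hu).symm
      · left
        rw [hfv u hu, hfv w hw]
    refine ⟨fun x => f '' M x, π, hπ, hM.image hf fun x y hxy => ?_, ?_⟩
    · exact Set.disjoint_left.2 fun s hs ht =>
        (hM.disjoint x y hxy).ne_of_mem (hfM x s hs) (hfM y s ht) rfl
    · intro i
      fin_cases i
      exacts [⟨a, hr 0, hfA a ha⟩, ⟨b, hr 1, hfA b hb⟩, ⟨c, hr 2, hfA c hc⟩, ⟨d, hr 3, hfA d hd⟩]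
  · rintro ⟨M, π, hπ, hM, hr⟩
    refine ⟨fun x => Subtype.val '' M x, π, hπ,
      hM.image (fun _ _ h => Or.inr h) fun x y hxy =>
        (Set.disjoint_image_iff Subtype.val_injective).2 (hM.disjoint x y hxy), ?_⟩
    intro i
    fin_cases i
    exacts [⟨_, hr 0, rfl⟩, ⟨_, hr 1, rfl⟩, ⟨_, hr 2, rfl⟩, ⟨_, hr 3, rfl⟩]
end Paper
end

section
/- Let H be a simple 2-connected graph, G a connected graph with a 1-separation (A,B) with A ∩ B = {v}, let X = {a,b,c,d} ⊆ V(G) be four distinct vertices, and let 𝓕 be a family of injective maps from X to V(H). If exactly two vertices of X lie in A \ {v} and exactly two vertices of X lie in B \ {v}, then G has no H(X)-minor. -/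
namespace Paper

open SimpleGraph

variable {V : Type*} {U : Type*}

theorem forall_of_preconnected {K : SimpleGraph V} (hK : K.Preconnected) {P : V → Prop}
    (hP : ∀ x y, K.Adj x y → P x → P y) {x : V} (hx : P x) (y : V) : P y := by
  obtain ⟨p⟩ := hK x y
  induction p with
  | nil => exact hx
  | cons h _ ih => exact ih (hP _ _ h hx)

theorem IsSeparation.mem_of_adj {G : SimpleGraph V} {A B : Set V} {v : V}
    (hsep : IsSeparation G A B) (hAB : A ∩ B = {v}) {x y : V} (hxy : G.Adj x y)
    (hx : x ∈ A \ {v}) (hy : y ≠ v) : y ∈ A \ {v} := by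
  refine ⟨?_, hy⟩
  by_contra hyA
  have hyB : y ∈ B := by
    have h : y ∈ A ∪ B := hsep.1 ▸ Set.mem_univ y
    exact h.resolve_left hyA
  have hxB : x ∉ B := fun hxB => hx.2 (hAB ▸ ⟨hx.1, hxB⟩)
  exact hsep.2 x y ⟨hx.1, hxB⟩ ⟨hyB, hyA⟩ hxy

theorem IsSeparation.subset_of_connected {G : SimpleGraph V} {A B : Set V} {v : V}
    (hsep : IsSeparation G A B) (hAB : A ∩ B = {v}) {S : Set V}
    (hS : (G.induce S).Connected) (hv : v ∉ S) {x : V} (hxS : x ∈ S) (hx : x ∈ A \ {v}) :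
    S ⊆ A \ {v} := fun y hy =>
  forall_of_preconnected hS.preconnected (P := fun z => (z : V) ∈ A \ {v})
    (fun _ z h hz => hsep.mem_of_adj hAB h hz fun e => hv (e ▸ z.2)) (x := ⟨x, hxS⟩) hx ⟨y, hy⟩

/-- If two roots in distinct branch sets lie in `C`, then some branch set avoiding `v`
meets `C`. -/
theorem IsModel.exists_branch_avoiding {ι W : Type*} {G : SimpleGraph V} {H : SimpleGraph W}
    {M : W → Set V} (hM : IsModel G H M) {r : ι → V} {π : ι → W} (hπ : Function.Injective π)
    (hr : ∀ i, r i ∈ M (π i)) (v : V) {C : Set V} (hC : (Set.range r ∩ C).ncard = 2) :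
    ∃ w, v ∉ M w ∧ ∃ x ∈ M w, x ∈ C := by
  obtain ⟨x, y, hxy, hset⟩ := Set.ncard_eq_two.1 hC
  obtain ⟨⟨i, rfl⟩, hxC⟩ : x ∈ Set.range r ∩ C := hset ▸ by simp
  obtain ⟨⟨j, rfl⟩, hyC⟩ : y ∈ Set.range r ∩ C := hset ▸ by simp
  have hij : π i ≠ π j := fun h => hxy (congrArg r (hπ h))
  by_cases hv : v ∈ M (π i)
  · exact ⟨π j, Set.disjoint_left.1 (hM.disjoint _ _ hij) hv, r j, hr j, hyC⟩
  · exact ⟨π i, hv, r i, hr i, hxC⟩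

/-- Cut vertex `v`; if exactly two vertices of `X` lie in `A \ {v}` and
exactly two lie in `B \ {v}`, then `G` has no `H(X)`-minor. -/
theorem cut_vertex_two_two_no_minor
    {V W : Type*} [Fintype V] [Fintype W]
    (H : SimpleGraph W) (hH2 : KConnected H 2)
    (G : SimpleGraph V) (hGconn : G.Connected)
    (A B : Set V) (v : V) (hsep : IsSeparation G A B) (hAB : A ∩ B = {v})
    (a b c d : V) (hab : a ≠ b) (hac : a ≠ c) (had : a ≠ d) (hbc : b ≠ c) (hbd : b ≠ d)
    (hcd : c ≠ d)
    (F : Set (Fin 4 → W)) (hF : ∀ π ∈ F, Function.Injective π)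
    (hA2 : (({a, b, c, d} : Set V) ∩ (A \ {v})).ncard = 2)
    (hB2 : (({a, b, c, d} : Set V) ∩ (B \ {v})).ncard = 2) :
    ¬ HasRootedMinor G H ![a, b, c, d] F := by
  rintro ⟨M, π, hπF, hM, hr⟩
  have hX : ({a, b, c, d} : Set V) = Set.range ![a, b, c, d] := by
    ext x
    simp [eq_comm]
    tauto
  rw [hX] at hA2 hB2
  obtain ⟨w, hw, x, hxw, hxA⟩ := hM.exists_branch_avoiding (hF π hπF) hr v hA2
  obtain ⟨w', hw', y, hyw, hyB⟩ := hM.exists_branch_avoiding (hF π hπF) hr v hB2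
  have hcard : {u | v ∈ M u}.ncard < 2 := by
    refine Nat.lt_succ_of_le ((Set.ncard_le_one (Set.toFinite _)).2 fun s hs t ht => ?_)
    by_contra hst
    exact Set.disjoint_left.1 (hM.disjoint _ _ hst) hs ht
  have hsub : M w' ⊆ A \ {v} :=
    forall_of_preconnected (hH2.2 _ hcard).preconnected (P := fun u => M u ⊆ A \ {v})
      (fun s t hst hs => by
        obtain ⟨p, hp, q, hq, hpq⟩ := hM.adj_of_adj hst
        exact hsep.subset_of_connected hAB (hM.connected t) t.2 hq
          (hsep.mem_of_adj hAB hpq (hs hp) fun e => t.2 (e ▸ hq : v ∈ M t)))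
      (x := ⟨w, hw⟩) (hsep.subset_of_connected hAB (hM.connected w) hw hxw hxA) ⟨w', hw'⟩
  exact hyB.2 (hAB ▸ ⟨(hsub hyw).1, hyB.1⟩)
end Paper
end

section
/- Let H be a simple 3-connected graph, G a 2-connected graph with a 2-separation (A,B) with A ∩ B = {u,v}, let X = {a,b,c,d} ⊆ V(G) be four distinct vertices, and let 𝓕 be a family of injective maps from X to V(H). Let G_B = G[B] plus the edge uv. Suppose a ∈ A \ {u,v} and b,c,d ∈ B \ {u,v}. Let X₁ = {u,b,c,d} and X₂ = {v,b,c,d}; for each π ∈ 𝓕 define π₁ : X₁ → V(H) by π₁ = π on {b,c,d} and π₁(u) = π(a), and π₂ : X₂ → V(H) by π₂ = π on {b,c,d} and π₂(v) = π(a); let 𝓕₁, 𝓕₂ be the resulting families. Then G has an H(X)-minor if and only if G_B has an H(X₁)-minor or G_B has an H(X₂)-minor. -/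
namespace Paper

open SimpleGraph

variable {V : Type*} {U : Type*}

/-- One step of a walk of `G` inside the vertex set `S`. -/
def StepIn (G : SimpleGraph V) (S : Set V) (p q : V) : Prop :=
  p ∈ S ∧ q ∈ S ∧ G.Adj p q

theorem reflTransGen_stepIn_of_connected {G : SimpleGraph V} {S : Set V}
    (h : (G.induce S).Connected) {p q : V} (hp : p ∈ S) (hq : q ∈ S) :
    Relation.ReflTransGen (StepIn G S) p q := by
  have h1 := (reachable_iff_reflTransGen _ _).1 (h.preconnected ⟨p, hp⟩ ⟨q, hq⟩)
  exact h1.lift Subtype.val fun x y hxy => ⟨x.2, y.2, hxy⟩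

theorem connected_induce_of_reflTransGen {G : SimpleGraph V} {S : Set V} {p : V}
    (hp : p ∈ S) (h : ∀ q ∈ S, Relation.ReflTransGen (StepIn G S) p q) :
    (G.induce S).Connected := by
  have key : ∀ q, Relation.ReflTransGen (StepIn G S) p q →
      ∀ hq : q ∈ S, (G.induce S).Reachable ⟨p, hp⟩ ⟨q, hq⟩ := by
    intro q hpq
    induction hpq with
    | refl => exact fun _ => Reachable.refl _
    | tail _ hst ih =>
      intro hq
      refine (ih hst.1).trans (Adj.reachable ?_)
      exact hst.2.2
  have : Nonempty S := ⟨⟨p, hp⟩⟩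
  refine ⟨fun x y => ?_⟩
  exact (key x (h x x.2) x.2).symm.trans (key y (h y y.2) y.2)

/-- A connected set that avoids the two attachment vertices of `B` and contains a vertex
outside `B` is disjoint from `B`. -/
theorem notMem_of_connected {G : SimpleGraph V} {B C : Set V} {u v : V}
    (hs : ∀ p q, p ∉ B → q ∈ B → G.Adj p q → q = u ∨ q = v)
    (hC : (G.induce C).Connected) (hu : u ∉ C) (hv : v ∉ C)
    {q : V} (hq : q ∈ C) (hqB : q ∉ B) {p : V} (hp : p ∈ C) : p ∉ B := by
  induction reflTransGen_stepIn_of_connected hC hq hp with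
  | refl => exact hqB
  | tail _ hst ih =>
    intro hB
    rcases hs _ _ (ih hst.1) hB hst.2.2 with rfl | rfl
    · exact hu hst.2.1
    · exact hv hst.2.1

/-- Restricting a connected set to `B` keeps it connected once the attachment vertices
of `B` are made adjacent. -/
theorem connected_restrict {G : SimpleGraph V} {B C : Set V} {u v : V}
    (hs : ∀ p q, p ∉ B → q ∈ B → G.Adj p q → q = u ∨ q = v)
    {K : SimpleGraph B}
    (hK : ∀ p q : B, K.Adj p q ↔ G.Adj p q ∨ (p.1 = u ∧ q.1 = v) ∨ (p.1 = v ∧ q.1 = u))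
    (hC : (G.induce C).Connected) {p : V} (hp : p ∈ C) (hpB : p ∈ B) :
    (K.induce {w : B | w.1 ∈ C}).Connected := by
  refine connected_induce_of_reflTransGen (p := ⟨p, hpB⟩) hp ?_
  have key : ∀ q, Relation.ReflTransGen (StepIn G C) p q →
      (∀ hq : q ∈ B, Relation.ReflTransGen (StepIn K {w : B | w.1 ∈ C}) ⟨p, hpB⟩ ⟨q, hq⟩) ∧
      (q ∉ B → ∃ z : B, z.1 ∈ C ∧ (z.1 = u ∨ z.1 = v) ∧
        Relation.ReflTransGen (StepIn K {w : B | w.1 ∈ C}) ⟨p, hpB⟩ z) := by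
    intro q hpq
    induction hpq with
    | refl => exact ⟨fun _ => .refl, fun h => absurd hpB h⟩
    | @tail x y _ hst ih =>
      obtain ⟨hx, hy, hxy⟩ := hst
      by_cases hxB : x ∈ B
      · refine ⟨fun hyB => (ih.1 hxB).tail ⟨hx, hy, (hK _ _).2 (.inl hxy)⟩, fun hyB => ?_⟩
        exact ⟨⟨x, hxB⟩, hx, hs _ _ hyB hxB hxy.symm, ih.1 hxB⟩
      · obtain ⟨z, hzC, hz, hpz⟩ := ih.2 hxB
        refine ⟨fun hyB => ?_, fun _ => ⟨z, hzC, hz, hpz⟩⟩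
        by_cases hzy : z = ⟨y, hyB⟩
        · exact hzy ▸ hpz
        · refine hpz.tail ⟨hzC, hy, (hK _ _).2 (.inr ?_)⟩
          have hzy' : z.1 ≠ y := fun h => hzy (Subtype.ext h)
          rcases hs _ _ hxB hyB hxy with hy' | hy' <;> rcases hz with hz | hz <;> simp_all
  intro q hq
  exact (key q (reflTransGen_stepIn_of_connected hC hp hq)).1 q.2

/-- In a model of a 3-connected graph with three distinct branch sets meeting one side
`B` of a 2-separation, every branch set not contained in `B` contains an attachment
vertex. -/
theorem attachment_mem_of_not_subset {W : Type*} [Fintype W] {H : SimpleGraph W}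
    (hH3 : KConnected H 3) {G : SimpleGraph V} {B : Set V} {u v : V}
    (hs : ∀ p q, p ∉ B → q ∈ B → G.Adj p q → q = u ∨ q = v)
    {C : W → Set V} (hC : IsModel G H C) {x₁ x₂ x₃ : W} (h₁₂ : x₁ ≠ x₂) (h₁₃ : x₁ ≠ x₃)
    (h₂₃ : x₂ ≠ x₃) {b c d : V} (hb : b ∈ C x₁) (hc : c ∈ C x₂) (hd : d ∈ C x₃)
    (hbB : b ∈ B) (hcB : c ∈ B) (hdB : d ∈ B) {y : W} {q : V} (hq : q ∈ C y)
    (hqB : q ∉ B) : u ∈ C y ∨ v ∈ C y := by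
  have huniq : ∀ {w : V} {x x' : W}, w ∈ C x → w ∈ C x' → x = x' := by
    intro w x x' h h'
    by_contra hne
    exact Set.disjoint_left.1 (hC.disjoint x x' hne) h h'
  by_contra hy
  set T : Set W := {x | u ∈ C x} ∪ {x | v ∈ C x}
  have hcard : T.ncard < 3 := by
    have h1 : ∀ w : V, {x | w ∈ C x}.ncard ≤ 1 := fun w =>
      (Set.ncard_le_one_iff (Set.toFinite _)).2 fun h h' => huniq h h'
    have : T.ncard ≤ _ := Set.ncard_union_le {x | u ∈ C x} {x | v ∈ C x}
    have := h1 u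
    have := h1 v
    omega
  have hconn := hH3.2 T hcard
  obtain ⟨x, hxT, p, hp, hpB⟩ : ∃ x, x ∉ T ∧ ∃ p ∈ C x, p ∈ B := by
    by_contra! hall
    have m₁ : x₁ ∈ T := by_contra fun h => hall x₁ h b hb hbB
    have m₂ : x₂ ∈ T := by_contra fun h => hall x₂ h c hc hcB
    have m₃ : x₃ ∈ T := by_contra fun h => hall x₃ h d hd hdB
    rcases m₁ with m₁ | m₁ <;> rcases m₂ with m₂ | m₂ <;> rcases m₃ with m₃ | m₃ <;>
      first
        | exact h₁₂ (huniq m₁ m₂)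
        | exact h₁₃ (huniq m₁ m₃)
        | exact h₂₃ (huniq m₂ m₃)
  have key : ∀ x, Relation.ReflTransGen (StepIn H Tᶜ) y x → ∀ p ∈ C x, p ∉ B := by
    intro x hyx
    induction hyx with
    | refl =>
      exact fun p hp => notMem_of_connected hs (hC.connected y) (fun h => hy (.inl h))
        (fun h => hy (.inr h)) hq hqB hp
    | @tail w w' _ hst ih =>
      obtain ⟨-, hw', hadj⟩ := hst
      obtain ⟨s, hs', t, ht, hst⟩ := hC.adj_of_adj hadj
      have hu : u ∉ C w' := fun h => hw' (.inl h)
      have hv : v ∉ C w' := fun h => hw' (.inr h)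
      have htB : t ∉ B := by
        intro htB
        rcases hs s t (ih s hs') htB hst with rfl | rfl
        · exact hu ht
        · exact hv ht
      exact fun p hp => notMem_of_connected hs (hC.connected w') hu hv ht htB hp
  exact key x (reflTransGen_stepIn_of_connected hconn hy hxT) p hp hpB

/-- A model all of whose branch sets leaving `B` contain an attachment vertex of `B`
restricts to a model in `B` with the attachment vertices made adjacent. -/
theorem isModel_restrict {W : Type*} {H : SimpleGraph W} {G : SimpleGraph V} {B : Set V}
    {u v : V} (hs : ∀ p q, p ∉ B → q ∈ B → G.Adj p q → q = u ∨ q = v)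
    {K : SimpleGraph B}
    (hK : ∀ p q : B, K.Adj p q ↔ G.Adj p q ∨ (p.1 = u ∧ q.1 = v) ∨ (p.1 = v ∧ q.1 = u))
    (huB : u ∈ B) (hvB : v ∈ B) {C : W → Set V} (hC : IsModel G H C)
    (hatt : ∀ y, ∀ q ∈ C y, q ∉ B → u ∈ C y ∨ v ∈ C y) :
    IsModel K H fun x => {w : B | w.1 ∈ C x} where
  connected x := by
    obtain ⟨p, hp, hpB⟩ : ∃ p ∈ C x, p ∈ B := by
      obtain ⟨⟨q, hq⟩⟩ := (hC.connected x).nonempty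
      by_cases hqB : q ∈ B
      · exact ⟨q, hq, hqB⟩
      · rcases hatt x q hq hqB with h | h
        exacts [⟨u, h, huB⟩, ⟨v, h, hvB⟩]
    exact connected_restrict hs hK (hC.connected x) hp hpB
  disjoint x y hxy := Set.disjoint_left.2 fun w hx hy =>
    Set.disjoint_left.1 (hC.disjoint x y hxy) hx hy
  adj_of_adj x y hxy := by
    obtain ⟨p, hp, q, hq, hpq⟩ := hC.adj_of_adj hxy
    by_cases hB : p ∈ B ∧ q ∈ B
    · exact ⟨⟨p, hB.1⟩, hp, ⟨q, hB.2⟩, hq, (hK _ _).2 (.inl hpq)⟩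
    · have hx : u ∈ C x ∨ v ∈ C x := by
        by_cases hpB : p ∈ B
        · rcases hs q p (fun h => hB ⟨hpB, h⟩) hpB hpq.symm with rfl | rfl
          exacts [.inl hp, .inr hp]
        · exact hatt x p hp hpB
      have hy : u ∈ C y ∨ v ∈ C y := by
        by_cases hqB : q ∈ B
        · rcases hs p q (fun h => hB ⟨h, hqB⟩) hqB hpq with rfl | rfl
          exacts [.inl hq, .inr hq]
        · exact hatt y q hq hqB
      have hdis := Set.disjoint_left.1 (hC.disjoint x y hxy.ne)
      rcases hx with hx | hx <;> rcases hy with hy | hy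
      · exact absurd hy (hdis hx)
      · exact ⟨⟨u, huB⟩, hx, ⟨v, hvB⟩, hy, (hK _ _).2 (.inr (.inl ⟨rfl, rfl⟩))⟩
      · exact ⟨⟨v, hvB⟩, hx, ⟨u, huB⟩, hy, (hK _ _).2 (.inr (.inr ⟨rfl, rfl⟩))⟩
      · exact absurd hy (hdis hx)

/-- A model in `B`, with the attachment vertices `u`, `v` made adjacent, becomes a model
in the whole 2-connected graph when the complement of `B` is added to the branch set
containing `u`. -/
theorem isModel_extend {W : Type*} {H : SimpleGraph W} {G : SimpleGraph V} {B : Set V}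
    {u v : V} (huv : u ≠ v)
    (hs : ∀ p q, p ∉ B → q ∈ B → G.Adj p q → q = u ∨ q = v)
    (hGu : (G.induce {u}ᶜ).Connected) (hGv : (G.induce {v}ᶜ).Connected)
    {K : SimpleGraph B}
    (hK : ∀ p q : B, K.Adj p q ↔ G.Adj p q ∨ (p.1 = u ∧ q.1 = v) ∨ (p.1 = v ∧ q.1 = u))
    (huB : u ∈ B) (hvB : v ∈ B) {a : V} (ha : a ∉ B) {C : W → Set B}
    (hC : IsModel K H C) {x₀ : W} (hu : ⟨u, huB⟩ ∈ C x₀) :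
    IsModel G H fun x => Subtype.val '' C x ∪ {w | w ∉ B ∧ x = x₀} := by
  have huniq : ∀ {w : B} {x x' : W}, w ∈ C x → w ∈ C x' → x = x' := by
    intro w x x' h h'
    by_contra hne
    exact Set.disjoint_left.1 (hC.disjoint x x' hne) h h'
  obtain ⟨z, hzB, hvz⟩ : ∃ z, z ∉ B ∧ G.Adj v z := by
    have hav : a ≠ u := fun h => ha (h ▸ huB)
    have key : ∀ q, Relation.ReflTransGen (StepIn G {u}ᶜ) v q → q ∉ B →
        ∃ z, z ∉ B ∧ G.Adj v z := by
      intro q hvq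
      induction hvq with
      | refl => exact fun h => absurd hvB h
      | @tail x y _ hst ih =>
        intro hy
        by_cases hx : x ∈ B
        · rcases hs y x hy hx hst.2.2.symm with h | h
          · exact absurd h hst.1
          · exact ⟨y, hy, h ▸ hst.2.2⟩
        · exact ih hx
    exact key a (reflTransGen_stepIn_of_connected hGu huv.symm hav) ha
  set D : W → Set V := fun x => Subtype.val '' C x ∪ {w | w ∉ B ∧ x = x₀}
  have huD : u ∈ D x₀ := .inl ⟨_, hu, rfl⟩
  have hout : ∀ {q}, q ∉ B → q ∈ D x₀ := fun hq => .inr ⟨hq, rfl⟩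
  have hreach : ∀ q, q ∉ B → Relation.ReflTransGen (StepIn G (D x₀)) u q := by
    intro q hq
    have hqv : q ≠ v := fun h => hq (h ▸ hvB)
    induction reflTransGen_stepIn_of_connected hGv huv hqv with
    | refl => exact absurd huB hq
    | @tail x y _ hst ih =>
      by_cases hx : x ∈ B
      · rcases hs y x hq hx hst.2.2.symm with h | h
        · subst h
          exact .single ⟨huD, hout hq, hst.2.2⟩
        · exact absurd h hst.1
      · exact (ih hx hst.1).tail ⟨hout hx, hout hq, hst.2.2⟩
  refine ⟨fun x => ?_, fun x y hxy => ?_, fun x y hxy => ?_⟩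
  · by_cases hx : x = x₀
    · subst hx
      refine connected_induce_of_reflTransGen huD fun q hq => ?_
      rcases hq with ⟨q, hq, rfl⟩ | ⟨hq, -⟩
      · induction reflTransGen_stepIn_of_connected (hC.connected x) hu hq with
        | refl => exact .refl
        | @tail s t _ hst ih =>
          rcases (hK _ _).1 hst.2.2 with h | ⟨-, h⟩ | ⟨-, h⟩
          · exact (ih hst.1).tail ⟨.inl ⟨s, hst.1, rfl⟩, .inl ⟨t, hst.2.1, rfl⟩, h⟩
          · exact (hreach z hzB).tail ⟨hout hzB, .inl ⟨t, hst.2.1, rfl⟩, h ▸ hvz.symm⟩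
          · rw [h]
      · exact hreach q hq
    · obtain ⟨⟨p, hp⟩⟩ := (hC.connected x).nonempty
      refine connected_induce_of_reflTransGen (p := p.1) (.inl ⟨p, hp, rfl⟩) fun q hq => ?_
      rcases hq with ⟨q, hq, rfl⟩ | ⟨-, h⟩
      · refine (reflTransGen_stepIn_of_connected (hC.connected x) hp hq).lift Subtype.val
          fun s t hst => ⟨.inl ⟨s, hst.1, rfl⟩, .inl ⟨t, hst.2.1, rfl⟩, ?_⟩
        have hne : ∀ w ∈ C x, w.1 ≠ u := by
          rintro w hw rfl
          exact hx (huniq hw hu)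
        rcases (hK _ _).1 hst.2.2 with h | ⟨h, -⟩ | ⟨-, h⟩
        · exact h
        · exact absurd h (hne s hst.1)
        · exact absurd h (hne t hst.2.1)
      · exact absurd h hx
  · refine Set.disjoint_left.2 ?_
    rintro _ (⟨p, hp, rfl⟩ | ⟨hp, rfl⟩) (⟨q, hq, hpq⟩ | ⟨hq, rfl⟩)
    · obtain rfl := Subtype.ext hpq
      exact hxy (huniq hp hq)
    · exact hq p.2
    · exact hp (hpq ▸ q.2)
    · exact hxy rfl
  · obtain ⟨p, hp, q, hq, hpq⟩ := hC.adj_of_adj hxy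
    rcases (hK _ _).1 hpq with h | ⟨h, h'⟩ | ⟨h, h'⟩
    · exact ⟨p, .inl ⟨p, hp, rfl⟩, q, .inl ⟨q, hq, rfl⟩, h⟩
    · obtain rfl : p = ⟨u, huB⟩ := Subtype.ext h
      obtain rfl := huniq hp hu
      exact ⟨z, hout hzB, q, .inl ⟨q, hq, rfl⟩, h' ▸ hvz.symm⟩
    · obtain rfl : q = ⟨u, huB⟩ := Subtype.ext h'
      obtain rfl := huniq hq hu
      exact ⟨p, .inl ⟨p, hp, rfl⟩, z, hout hzB, h ▸ hvz⟩

/-- 2-separation `(A,B)` with `A ∩ B = {u,v}`, `a ∈ A \ {u,v}` and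
`b,c,d ∈ B \ {u,v}`.  With `X₁ = {u,b,c,d}`, `π₁(u) = π(a)`, `π₁ = π` on `{b,c,d}` and
`X₂ = {v,b,c,d}`, `π₂(v) = π(a)`, `π₂ = π` on `{b,c,d}` (so that in the tuple
representation over the ordered roots `(u,b,c,d)` resp. `(v,b,c,d)` the derived
families are again `F`): `G` has an `H(X)`-minor iff `G_B` has an `H(X₁)`-minor or an
`H(X₂)`-minor. -/
theorem two_sep_one_root_one_side
    {V W : Type*} [Fintype V] [Fintype W]
    (H : SimpleGraph W) (hH3 : KConnected H 3)
    (G : SimpleGraph V) (hG2 : KConnected G 2)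
    (A B : Set V) (u v : V) (huv : u ≠ v)
    (hsep : IsSeparation G A B) (hAB : A ∩ B = {u, v})
    (huB : u ∈ B) (hvB : v ∈ B)
    (a b c d : V) (hab : a ≠ b) (hac : a ≠ c) (had : a ≠ d) (hbc : b ≠ c) (hbd : b ≠ d)
    (hcd : c ≠ d)
    (F : Set (Fin 4 → W)) (hF : ∀ π ∈ F, Function.Injective π)
    (ha : a ∈ A \ {u, v}) (hb : b ∈ B \ {u, v}) (hc : c ∈ B \ {u, v})
    (hd : d ∈ B \ {u, v}) :
    HasRootedMinor G H ![a, b, c, d] F ↔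
      (HasRootedMinor
          (G.induce B ⊔ SimpleGraph.fromEdgeSet {s((⟨u, huB⟩ : B), (⟨v, hvB⟩ : B))}) H
          ![(⟨u, huB⟩ : B), ⟨b, hb.1⟩, ⟨c, hc.1⟩, ⟨d, hd.1⟩] F ∨
       HasRootedMinor
          (G.induce B ⊔ SimpleGraph.fromEdgeSet {s((⟨u, huB⟩ : B), (⟨v, hvB⟩ : B))}) H
          ![(⟨v, hvB⟩ : B), ⟨b, hb.1⟩, ⟨c, hc.1⟩, ⟨d, hd.1⟩] F) := by
  have haB : a ∉ B := fun h => ha.2 (hAB ▸ ⟨ha.1, h⟩)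
  have hs : ∀ p q, p ∉ B → q ∈ B → G.Adj p q → q = u ∨ q = v := by
    intro p q hp hq hpq
    have hpA : p ∈ A := (hsep.1 ▸ Set.mem_univ p : p ∈ A ∪ B).resolve_right hp
    have hqA : q ∈ A := by
      by_contra hqA
      exact hsep.2 p q ⟨hpA, hp⟩ ⟨hq, hqA⟩ hpq
    have hqAB : q ∈ A ∩ B := ⟨hqA, hq⟩
    rw [hAB] at hqAB
    exact hqAB
  set K := G.induce B ⊔ SimpleGraph.fromEdgeSet {s((⟨u, huB⟩ : B), (⟨v, hvB⟩ : B))}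
  have hK : ∀ p q : B, K.Adj p q ↔
      G.Adj p q ∨ (p.1 = u ∧ q.1 = v) ∨ (p.1 = v ∧ q.1 = u) := by
    rintro ⟨p, hp⟩ ⟨q, hq⟩
    simp only [K, sup_adj, comap_adj, Function.Embedding.subtype_apply, fromEdgeSet_adj,
      Set.mem_singleton_iff, Sym2.eq_iff, Subtype.mk.injEq, ne_eq]
    grind
  have hG : ∀ w : V, (G.induce {w}ᶜ).Connected := fun w => hG2.2 {w} (by simp)
  constructor
  · rintro ⟨C, π, hπ, hC, hr⟩
    have hinj := hF π hπ
    have hatt : ∀ y, ∀ q ∈ C y, q ∉ B → u ∈ C y ∨ v ∈ C y := fun y q hq hqB =>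
      attachment_mem_of_not_subset hH3 hs hC (hinj.ne (by decide : (1 : Fin 4) ≠ 2))
        (hinj.ne (by decide : (1 : Fin 4) ≠ 3)) (hinj.ne (by decide : (2 : Fin 4) ≠ 3))
        (hr 1) (hr 2) (hr 3) hb.1 hc.1 hd.1 hq hqB
    have hmodel := isModel_restrict hs hK huB hvB hC hatt
    rcases hatt (π 0) a (hr 0) haB with h | h
    · refine .inl ⟨_, π, hπ, hmodel, fun i => ?_⟩
      fin_cases i
      exacts [h, hr 1, hr 2, hr 3]
    · refine .inr ⟨_, π, hπ, hmodel, fun i => ?_⟩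
      fin_cases i
      exacts [h, hr 1, hr 2, hr 3]
  · rintro (⟨C, π, hπ, hC, hr⟩ | ⟨C, π, hπ, hC, hr⟩)
    · refine ⟨_, π, hπ, isModel_extend huv hs (hG u) (hG v) hK huB hvB haB hC (hr 0),
        fun i => ?_⟩
      fin_cases i
      exacts [.inr ⟨haB, rfl⟩, .inl ⟨_, hr 1, rfl⟩, .inl ⟨_, hr 2, rfl⟩, .inl ⟨_, hr 3, rfl⟩]
    · refine ⟨_, π, hπ, isModel_extend huv.symm (fun p q hp hq h => (hs p q hp hq h).symm)
        (hG v) (hG u) (fun p q => (hK p q).trans (or_congr_right or_comm)) hvB huB haB hC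
        (hr 0), fun i => ?_⟩
      fin_cases i
      exacts [.inr ⟨haB, rfl⟩, .inl ⟨_, hr 1, rfl⟩, .inl ⟨_, hr 2, rfl⟩, .inl ⟨_, hr 3, rfl⟩]

end Paper
end

section
/- Let H be a simple 3-connected graph, G a 2-connected graph with a 2-separation (A,B) with A ∩ B = {u,v}, let X = {a,b,c,d} ⊆ V(G) be four distinct vertices, and let 𝓕 be a family of injective maps from X to V(H). Suppose {u,v} ⊆ X, one of the two remaining vertices of X lies in A \ {u,v}, and the other lies in B \ {u,v}. Then G has no H(X)-minor. -/
namespace Paper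

open SimpleGraph

variable {V : Type*} {U : Type*}

theorem exists_root_index {a b c d x : V} (hx : x ∈ ({a, b, c, d} : Set V)) :
    ∃ i : Fin 4, ![a, b, c, d] i = x := by
  rcases hx with rfl | rfl | rfl | rfl
  exacts [⟨0, rfl⟩, ⟨1, rfl⟩, ⟨2, rfl⟩, ⟨3, rfl⟩]

theorem _root_.SimpleGraph.Preconnected.of_forall_adj {K : SimpleGraph V} (hK : K.Preconnected)
    {P : V → Prop} (hP : ∀ x y, K.Adj x y → P x → P y) {x y : V} (hx : P x) : P y := by
  obtain ⟨p⟩ := hK x y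
  induction p with
  | nil => exact hx
  | cons h _ ih => exact ih (hP _ _ h hx)

theorem IsSeparation.mem_left_of_adj {G : SimpleGraph V} {A B : Set V} (hsep : IsSeparation G A B)
    {x y : V} (hxy : G.Adj x y) (hx : x ∉ A ∩ B) (hxA : x ∈ A) : y ∈ A := by
  by_contra hyA
  have hy : y ∈ A ∪ B := hsep.1 ▸ Set.mem_univ y
  exact hsep.2 x y ⟨hxA, fun hxB => hx ⟨hxA, hxB⟩⟩ ⟨hy.resolve_left hyA, hyA⟩ hxy

theorem IsSeparation.subset_left_of_connected {G : SimpleGraph V} {A B M : Set V}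
    (hsep : IsSeparation G A B) (hM : (G.induce M).Connected) (hd : Disjoint M (A ∩ B))
    {x : V} (hx : x ∈ M) (hxA : x ∈ A) : M ⊆ A := fun y hy =>
  hM.preconnected.of_forall_adj (P := fun z : M => (z : V) ∈ A) (x := ⟨x, hx⟩) (y := ⟨y, hy⟩)
    (fun z _ hzw hz => hsep.mem_left_of_adj hzw (Set.disjoint_left.1 hd z.2) hz) hxA

/-- 2-separation `(A,B)` with `A ∩ B = {u,v} ⊆ X`; if one of the two
remaining vertices of `X` lies in `A \ {u,v}` and the other lies in `B \ {u,v}`, then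
`G` has no `H(X)`-minor. -/
theorem two_sep_cut_roots_no_minor
    {V W : Type*} [Fintype V] [Fintype W]
    (H : SimpleGraph W) (hH3 : KConnected H 3)
    (G : SimpleGraph V) (hG2 : KConnected G 2)
    (A B : Set V) (u v : V) (huv : u ≠ v)
    (hsep : IsSeparation G A B) (hAB : A ∩ B = {u, v})
    (a b c d : V) (hab : a ≠ b) (hac : a ≠ c) (had : a ≠ d) (hbc : b ≠ c) (hbd : b ≠ d)
    (hcd : c ≠ d)
    (F : Set (Fin 4 → W)) (hF : ∀ π ∈ F, Function.Injective π)
    (huX : u ∈ ({a, b, c, d} : Set V)) (hvX : v ∈ ({a, b, c, d} : Set V))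
    (hA : ∃ p ∈ ({a, b, c, d} : Set V) \ {u, v}, p ∈ A \ {u, v})
    (hB : ∃ q ∈ ({a, b, c, d} : Set V) \ {u, v}, q ∈ B \ {u, v}) :
    ¬ HasRootedMinor G H ![a, b, c, d] F := by
  rintro ⟨M, π, hπ, hM, hr⟩
  obtain ⟨p, ⟨hpX, hpuv⟩, hpA, -⟩ := hA
  obtain ⟨q, ⟨hqX, hquv⟩, hqB, -⟩ := hB
  obtain ⟨i, hi⟩ := exists_root_index huX
  obtain ⟨j, hj⟩ := exists_root_index hvX
  obtain ⟨k, hk⟩ := exists_root_index hpX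
  obtain ⟨l, hl⟩ := exists_root_index hqX
  have hui : u ∈ M (π i) := hi ▸ hr i
  have hvj : v ∈ M (π j) := hj ▸ hr j
  have hpk : p ∈ M (π k) := hk ▸ hr k
  have hql : q ∈ M (π l) := hl ▸ hr l
  have hS : ({π i, π j} : Set W).ncard < 3 := (Set.ncard_insert_le _ _).trans_lt (by simp)
  have hmem : ∀ {m x}, ![a, b, c, d] m = x → x ∉ ({u, v} : Set V) →
      π m ∈ ({π i, π j} : Set W)ᶜ := by
    rintro m x rfl hx (h | h)
    · exact hx (Or.inl (hF π hπ h ▸ hi))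
    · exact hx (Or.inr (hF π hπ h ▸ hj))
  have havoid : ∀ w ∈ ({π i, π j} : Set W)ᶜ, Disjoint (M w) (A ∩ B) := by
    intro w hw
    rw [hAB, Set.disjoint_right]
    rintro x (rfl | rfl) hx
    · exact Set.disjoint_left.1 (hM.disjoint w _ fun h => hw (Or.inl h)) hx hui
    · exact Set.disjoint_left.1 (hM.disjoint w _ fun h => hw (Or.inr h)) hx hvj
  have hsub : ∀ w ∈ ({π i, π j} : Set W)ᶜ, (∃ x ∈ M w, x ∈ A) → M w ⊆ A :=
    fun w hw ⟨_, hx, hxA⟩ => hsep.subset_left_of_connected (hM.connected w) (havoid w hw) hx hxA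
  have hl' := hmem hl hquv
  have hex : ∃ x ∈ M (π l), x ∈ A :=
    (hH3.2 _ hS).preconnected.of_forall_adj
      (P := fun w : ↥({π i, π j} : Set W)ᶜ => ∃ x ∈ M w, x ∈ A)
      (x := ⟨π k, hmem hk hpuv⟩) (y := ⟨π l, hl'⟩)
      (fun w w' hww' hw => by
        obtain ⟨x, hx, y, hy, hxy⟩ := hM.adj_of_adj hww'
        exact ⟨y, hy, hsep.mem_left_of_adj hxy (Set.disjoint_left.1 (havoid w w.2) hx)
          (hsub w w.2 hw hx)⟩)
      ⟨p, hpk, hpA⟩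
  exact Set.disjoint_left.1 (havoid _ hl') hql ⟨hsub _ hl' hex hql, hqB⟩
end Paper
end
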